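/- arXiv:1808.10849 — 2 statements merged into one kernel-verified Lean document; each statement's English description precedes it below -/
import Mathlib

section
/- Let δ_p be a smooth rational curve of degree d+1 in ℂP^d, d ≥ 4 (i.e., δ_p is irreducible, non-degenerate, rational and smooth). Then for all but at most three points q ∈ δ_p, the Zariski closure of the projection π_q(δ_p∖{q}) is a smooth rational curve of degree d in ℂP^{d−1}. -/
open scoped Pointwise
open Classical

noncomputable section

/-- `n`-dimensional projective space over `𝔽`. -/
abbrev PS (𝔽 : Type) [Field 𝔽] (n : ℕ) := Projectivization 𝔽 (Fin (n + 1) → 𝔽)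

/-- A projective flat of projective dimension `r - 1` (linear rank `r`), as a set of points. -/
def IsFlatOfRank {𝔽 : Type} [Field 𝔽] {n : ℕ} (r : ℕ) (S : Set (PS 𝔽 n)) : Prop :=
  ∃ W : Submodule 𝔽 (Fin (n + 1) → 𝔽), Module.finrank 𝔽 W = r ∧ S = {x | x.submodule ≤ W}

/-- A hyperplane of `PS 𝔽 n`, as a set of points. -/
def IsHypSet {𝔽 : Type} [Field 𝔽] {n : ℕ} (S : Set (PS 𝔽 n)) : Prop := IsFlatOfRank n S

/-- The linear span of a set of projective points. -/
def projSpan {𝔽 : Type} [Field 𝔽] {n : ℕ} (S : Set (PS 𝔽 n)) : Submodule 𝔽 (Fin (n + 1) → 𝔽) :=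
  ⨆ x ∈ S, x.submodule

/-- Every `d` points of `P` span a hyperplane (of `PS 𝔽 d`). -/
def SpanEveryd {𝔽 : Type} [Field 𝔽] {n : ℕ} (d : ℕ) (P : Set (PS 𝔽 n)) : Prop :=
  ∀ S : Set (PS 𝔽 n), S ⊆ P → S.Finite → S.ncard = d → Module.finrank 𝔽 (projSpan S) = d

/-- The hyperplanes passing through exactly `k` points of `P`. -/
def hypThrough {𝔽 : Type} [Field 𝔽] {n : ℕ} (P : Set (PS 𝔽 n)) (k : ℕ) :
    Set (Submodule 𝔽 (Fin (n + 1) → 𝔽)) :=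
  {W | Module.finrank 𝔽 W = n ∧ ({x ∈ P | x.submodule ≤ W}).ncard = k}

/-- The number of hyperplanes passing through exactly `k` points of `P`.
`numHyp P n` is the number of ordinary hyperplanes of `P ⊆ PS 𝔽 n`;
`numHyp P (n+1)` is the number of `(n+1)`-point hyperplanes. -/
def numHyp {𝔽 : Type} [Field 𝔽] {n : ℕ} (P : Set (PS 𝔽 n)) (k : ℕ) : ℕ :=
  (hypThrough P k).ncard
/-- The projective zero locus of a set of (homogeneous) polynomials. -/
def projZeroLocus {n : ℕ} (S : Set (MvPolynomial (Fin (n + 1)) ℂ)) : Set (PS ℂ n) :=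
  {x | ∀ f ∈ S, ∀ v ∈ x.submodule, MvPolynomial.eval v f = 0}

/-- A (closed, projective) algebraic set in `ℂPⁿ`. -/
def IsAlg {n : ℕ} (V : Set (PS ℂ n)) : Prop :=
  ∃ S : Set (MvPolynomial (Fin (n + 1)) ℂ),
    (∀ f ∈ S, ∃ e, f.IsHomogeneous e) ∧ V = projZeroLocus S

/-- The Zariski closure of a set of points of `ℂPⁿ`. -/
def zclosure {n : ℕ} (A : Set (PS ℂ n)) : Set (PS ℂ n) :=
  ⋂₀ {V | IsAlg V ∧ A ⊆ V}

/-- An irreducible algebraic set in `ℂPⁿ`. -/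
def IsIrredAlg {n : ℕ} (V : Set (PS ℂ n)) : Prop :=
  IsAlg V ∧ V.Nonempty ∧
    ∀ V₁ V₂ : Set (PS ℂ n), IsAlg V₁ → IsAlg V₂ → V ⊆ V₁ ∪ V₂ → V ⊆ V₁ ∨ V ⊆ V₂

/-- An irreducible component of an algebraic set. -/
def IsComponentOf {n : ℕ} (C V : Set (PS ℂ n)) : Prop :=
  IsIrredAlg C ∧ C ⊆ V ∧ ∀ C' : Set (PS ℂ n), IsIrredAlg C' → C' ⊆ V → C ⊆ C' → C = C'

/-- `V` is non-degenerate: it is not contained in a hyperplane. -/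
def NonDeg {n : ℕ} (V : Set (PS ℂ n)) : Prop := ∀ S : Set (PS ℂ n), IsHypSet S → ¬V ⊆ S

/-- `V` is non-planar: it is not contained in a 2-flat. -/
def NonPlanar {n : ℕ} (V : Set (PS ℂ n)) : Prop := ∀ S : Set (PS ℂ n), IsFlatOfRank 3 S → ¬V ⊆ S

/-- A projective variety of pure dimension 1: it is algebraic, some hyperplane meets it in
finitely many points (dimension at most 1), and every irreducible component is infinite
(dimension at least 1). -/
def IsPureCurve {n : ℕ} (V : Set (PS ℂ n)) : Prop :=
  IsAlg V ∧ (∃ S : Set (PS ℂ n), IsHypSet S ∧ (V ∩ S).Finite) ∧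
    ∀ C, IsComponentOf C V → C.Infinite

/-- A curve of degree `e` in `ℂPⁿ`: a pure 1-dimensional variety such that the maximum number
of points in a finite intersection with a hyperplane is `e`. -/
def IsCurveDeg {n : ℕ} (V : Set (PS ℂ n)) (e : ℕ) : Prop :=
  IsPureCurve V ∧
    IsGreatest {m : ℕ | ∃ S : Set (PS ℂ n), IsHypSet S ∧ (V ∩ S).Finite ∧ (V ∩ S).ncard = m} e

/-- All homogeneous polynomials vanishing on `V`. -/
def vanishingForms {n : ℕ} (V : Set (PS ℂ n)) : Set (MvPolynomial (Fin (n + 1)) ℂ) :=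
  {f | (∃ e, f.IsHomogeneous e) ∧ ∀ x ∈ V, ∀ v ∈ x.submodule, MvPolynomial.eval v f = 0}

/-- The (affine cone of the) Zariski tangent space of `V` at `x`. -/
def tangentSpaceAt {n : ℕ} (V : Set (PS ℂ n)) (x : PS ℂ n) : Submodule ℂ (Fin (n + 1) → ℂ) :=
  ⨅ f ∈ vanishingForms V,
    LinearMap.ker (∑ i : Fin (n + 1),
      MvPolynomial.eval x.rep (MvPolynomial.pderiv i f) •
        (LinearMap.proj i : (Fin (n + 1) → ℂ) →ₗ[ℂ] ℂ))

/-- A smooth point of a curve `V`: the tangent space has (affine) dimension 2. -/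
def IsSmoothPt {n : ℕ} (V : Set (PS ℂ n)) (x : PS ℂ n) : Prop :=
  x ∈ V ∧ Module.finrank ℂ (tangentSpaceAt V x) = 2

/-- The set of smooth points of a curve `V`. -/
def smoothPts {n : ℕ} (V : Set (PS ℂ n)) : Set (PS ℂ n) := {x | IsSmoothPt V x}

/-- A smooth curve. -/
def IsSmoothCurve {n : ℕ} (V : Set (PS ℂ n)) : Prop := ∀ x ∈ V, IsSmoothPt V x

/-- A real point of `ℂPⁿ`: one admitting a representative vector with real coordinates. -/
def IsRealPt {n : ℕ} (x : PS ℂ n) : Prop := ∃ v ∈ x.submodule, v ≠ 0 ∧ ∀ i, (v i).im = 0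

/-- A real curve: each irreducible component contains infinitely many real points. -/
def IsRealCurve {n : ℕ} (V : Set (PS ℂ n)) : Prop :=
  ∀ C, IsComponentOf C V → {x ∈ C | IsRealPt x}.Infinite

/-- The natural embedding `ℝPⁿ → ℂPⁿ`. -/
def cx {n : ℕ} (x : PS ℝ n) : PS ℂ n :=
  Projectivization.mk ℂ (fun i => (x.rep i : ℂ)) (by
    intro hc
    apply x.rep_nonzero
    funext i
    have h := congrFun hc i
    simp only [Pi.zero_apply] at h ⊢
    exact_mod_cast h)
/-- `q` is a (base-point-free) parametrisation of `V` by the projective line, with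
homogeneous coordinate functions of degree `e`. -/
def IsParamOf {n : ℕ} (q : Fin (n + 1) → MvPolynomial (Fin 2) ℂ) (V : Set (PS ℂ n)) (e : ℕ) :
    Prop :=
  (∀ i, (q i).IsHomogeneous e) ∧
  (∀ s : Fin 2 → ℂ, s ≠ 0 → (fun i => MvPolynomial.eval s (q i)) ≠ 0) ∧
  V = {x : PS ℂ n | ∃ s : Fin 2 → ℂ, ∃ hs : (fun i => MvPolynomial.eval s (q i)) ≠ 0,
        x = Projectivization.mk ℂ (fun i => MvPolynomial.eval s (q i)) hs}

/-- A rational curve of degree `e` in `ℂPⁿ`: can be parametrised by the projective line via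
homogeneous polynomials of degree `e`. -/
def IsRationalCurve {n : ℕ} (V : Set (PS ℂ n)) (e : ℕ) : Prop := ∃ q, IsParamOf q V e

/-- An elliptic normal curve in `ℂPⁿ`: an irreducible non-degenerate smooth curve of degree
`n + 1` isomorphic to a plane elliptic curve; equivalently (since an irreducible
non-degenerate curve of degree `n + 1` in `ℂPⁿ` is either an elliptic normal curve or
rational), such a smooth curve that is not rational. -/
def IsEllipticNormal {n : ℕ} (V : Set (PS ℂ n)) : Prop :=
  IsIrredAlg V ∧ NonDeg V ∧ IsCurveDeg V (n + 1) ∧ IsSmoothCurve V ∧ ¬∃ e, IsRationalCurve V e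

/-- A rational singular curve: an irreducible non-degenerate singular rational curve of degree
`n + 1` in `ℂPⁿ`. -/
def IsRationalSingular {n : ℕ} (V : Set (PS ℂ n)) : Prop :=
  IsIrredAlg V ∧ NonDeg V ∧ IsCurveDeg V (n + 1) ∧ IsRationalCurve V (n + 1) ∧ ¬IsSmoothCurve V

/-- The parametrisation `q` is injective as a map on the projective line. -/
def ParamInjective {n : ℕ} (q : Fin (n + 1) → MvPolynomial (Fin 2) ℂ) : Prop :=
  ∀ s t : Fin 2 → ℂ, s ≠ 0 → t ≠ 0 →
    (∃ c : ℂ, c ≠ 0 ∧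
      (fun i => MvPolynomial.eval s (q i)) = c • fun i => MvPolynomial.eval t (q i)) →
    ∃ c : ℂ, c ≠ 0 ∧ s = c • t

/-- A parametrisation with real coefficients. -/
def IsRealParam {n : ℕ} (q : Fin (n + 1) → MvPolynomial (Fin 2) ℂ) : Prop :=
  ∀ i m, ((q i).coeff m).im = 0

/-- A rational cuspidal curve: the singularity is a cusp, i.e. the parametrisation is
injective. -/
def IsCuspidalCurve {n : ℕ} (V : Set (PS ℂ n)) : Prop :=
  IsRationalSingular V ∧ ∃ q, IsParamOf q V (n + 1) ∧ ParamInjective q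

/-- A rational acnodal curve: a real rational singular curve whose singularity is a node whose
two branches correspond to a pair of complex-conjugate (non-real) parameter values of a real
parametrisation. -/
def IsAcnodalCurve {n : ℕ} (V : Set (PS ℂ n)) : Prop :=
  IsRationalSingular V ∧ IsRealCurve V ∧
  ∃ q, IsParamOf q V (n + 1) ∧ IsRealParam q ∧
    ∃ s t : Fin 2 → ℂ, s ≠ 0 ∧ t ≠ 0 ∧ (¬∃ c : ℂ, s = c • t) ∧
      (∃ c : ℂ, c ≠ 0 ∧
        (fun i => MvPolynomial.eval s (q i)) = c • fun i => MvPolynomial.eval t (q i)) ∧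
      (∃ c : ℂ, c ≠ 0 ∧ t = c • fun j => starRingEnd ℂ (s j))

/-- A rational crunodal curve: a real rational singular curve whose singularity is a node whose
two branches correspond to two distinct real parameter values of a real parametrisation. -/
def IsCrunodalCurve {n : ℕ} (V : Set (PS ℂ n)) : Prop :=
  IsRationalSingular V ∧ IsRealCurve V ∧
  ∃ q, IsParamOf q V (n + 1) ∧ IsRealParam q ∧
    ∃ s t : Fin 2 → ℂ, s ≠ 0 ∧ t ≠ 0 ∧ (¬∃ c : ℂ, s = c • t) ∧
      (∀ j, (s j).im = 0) ∧ (∀ j, (t j).im = 0) ∧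
      (∃ c : ℂ, c ≠ 0 ∧
        (fun i => MvPolynomial.eval s (q i)) = c • fun i => MvPolynomial.eval t (q i))
/-- The image of a set `A ⊆ ℂPⁿ⁺¹` under the projection induced by the linear map `f`. -/
def projImage {n : ℕ} (f : (Fin (n + 2) → ℂ) →ₗ[ℂ] (Fin (n + 1) → ℂ))
    (A : Set (PS ℂ (n + 1))) : Set (PS ℂ n) :=
  {y | ∃ x ∈ A, ∃ h : f x.rep ≠ 0, y = Projectivization.mk ℂ (f x.rep) h}

/-- The projection induced by `f` is generically one-to-one on `A`: it is injective away
from some finite subset of `A`. -/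
def GenOneToOneOn {n : ℕ} (f : (Fin (n + 2) → ℂ) →ₗ[ℂ] (Fin (n + 1) → ℂ))
    (A : Set (PS ℂ (n + 1))) : Prop :=
  ∃ S : Set (PS ℂ (n + 1)), S.Finite ∧
    ∀ x₁ ∈ A \ S, ∀ x₂ ∈ A \ S,
      (∃ c : ℂ, c ≠ 0 ∧ f x₁.rep = c • f x₂.rep) → x₁ = x₂

open MvPolynomial in
/-- The space of binary forms of degree `k`. -/
abbrev binForms (k : ℕ) : Submodule ℂ (MvPolynomial (Fin 2) ℂ) :=
  MvPolynomial.homogeneousSubmodule (Fin 2) ℂ k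

namespace binForms

open MvPolynomial

/-- The linear form vanishing at the point `s` of the projective line. -/
def lin (s : Fin 2 → ℂ) : MvPolynomial (Fin 2) ℂ := C (s 1) * X 0 - C (s 0) * X 1

theorem eval_lin (s t : Fin 2 → ℂ) : eval t (lin s) = s 1 * t 0 - s 0 * t 1 := by
  simp [lin]

theorem lin_mem (s : Fin 2 → ℂ) : lin s ∈ binForms 1 :=
  (isHomogeneous_C_mul_X _ _).sub (isHomogeneous_C_mul_X _ _)

theorem lin_ne_zero {s : Fin 2 → ℂ} (hs : s ≠ 0) : lin s ≠ 0 := by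
  intro h
  apply hs
  have h0 := congrArg (eval ![1, 0]) h
  have h1 := congrArg (eval ![0, 1]) h
  simp only [eval_lin] at h0 h1
  funext i
  fin_cases i <;> simp_all

theorem exists_smul_of_eval_lin_eq_zero {s t : Fin 2 → ℂ} (hs : s ≠ 0) (h : eval t (lin s) = 0) :
    ∃ c : ℂ, t = c • s := by
  rw [eval_lin] at h
  by_cases h0 : s 0 = 0
  · have h1 : s 1 ≠ 0 := fun h1 => hs (by funext i; fin_cases i <;> simp_all)
    refine ⟨t 1 / s 1, ?_⟩
    funext i
    fin_cases i
    · simp_all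
    · simp [h1]
  · refine ⟨t 0 / s 0, ?_⟩
    funext i
    fin_cases i
    · simp [h0]
    · simp only [Fin.mk_one, Pi.smul_apply, smul_eq_mul]
      field_simp
      linear_combination -h

theorem eval_lin_self (s : Fin 2 → ℂ) : eval s (lin s) = 0 := by
  simp [eval_lin]; ring

theorem mul_mem {k l : ℕ} {g h : MvPolynomial (Fin 2) ℂ} (hg : g ∈ binForms k)
    (hh : h ∈ binForms l) : g * h ∈ binForms (k + l) :=
  IsHomogeneous.mul hg hh

/-- The monomial `x ^ i * y ^ (k - i)`. -/
def mono (k i : ℕ) : MvPolynomial (Fin 2) ℂ := X 0 ^ i * X 1 ^ (k - i)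

theorem mono_mem {k i : ℕ} (hi : i ≤ k) : mono k i ∈ binForms k := by
  have := (isHomogeneous_X_pow (R := ℂ) (0 : Fin 2) i).mul
    (isHomogeneous_X_pow (R := ℂ) (1 : Fin 2) (k - i))
  rwa [Nat.add_sub_cancel' hi] at this

theorem mono_mul_mono {k l i j : ℕ} (hi : i ≤ k) (hj : j ≤ l) :
    mono k i * mono l j = mono (k + l) (i + j) := by
  obtain ⟨a, rfl⟩ := Nat.exists_eq_add_of_le hi
  obtain ⟨b, rfl⟩ := Nat.exists_eq_add_of_le hj
  have : i + a + (j + b) - (i + j) = a + b := by omega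
  simp only [mono, this, Nat.add_sub_cancel_left]
  ring

theorem eval_mono (s : Fin 2 → ℂ) (k i : ℕ) : eval s (mono k i) = s 0 ^ i * s 1 ^ (k - i) := by
  simp [mono]

theorem mono_eq_monomial (k i : ℕ) :
    mono k i = monomial (Finsupp.single 0 i + Finsupp.single 1 (k - i)) 1 := by
  rw [mono, X_pow_eq_monomial, X_pow_eq_monomial, monomial_mul, one_mul]

theorem linearIndependent_mono (k : ℕ) :
    LinearIndependent ℂ (fun i : Fin (k + 1) => mono k i) := by
  have h := (basisMonomials (Fin 2) ℂ).linearIndependent.comp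
    (fun i : Fin (k + 1) =>
      (Finsupp.single 0 (i : ℕ) + Finsupp.single 1 (k - i) : Fin 2 →₀ ℕ)) (by
      intro i j hij
      have := DFunLike.congr_fun hij 0
      simp at this
      exact Fin.ext this)
  have heq : (fun i : Fin (k + 1) => mono k i) = basisMonomials (Fin 2) ℂ ∘
      fun i : Fin (k + 1) =>
        (Finsupp.single 0 (i : ℕ) + Finsupp.single 1 (k - i) : Fin 2 →₀ ℕ) := by
    funext i
    simp only [mono_eq_monomial, Function.comp_apply, coe_basisMonomials]
  rw [heq]
  exact h

theorem eq_span_mono (k : ℕ) :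
    binForms k = Submodule.span ℂ (Set.range fun i : Fin (k + 1) => mono k i) := by
  apply le_antisymm
  · intro g hg
    rw [← support_sum_monomial_coeff g]
    refine Submodule.sum_mem _ fun d hd => ?_
    have hdk : d 0 + d 1 = k := by
      rw [IsHomogeneous.degree_eq_sum_deg_support hg hd, ← Finsupp.degree_apply,
        Finsupp.degree_eq_sum, Fin.sum_univ_two]
    have hmono : monomial d (coeff d g) = coeff d g • mono k (d 0) := by
      rw [mono_eq_monomial, smul_monomial, smul_eq_mul, mul_one]
      have hd' : d = Finsupp.single 0 (d 0) + Finsupp.single 1 (k - d 0) := by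
        refine Finsupp.ext fun i => ?_
        fin_cases i
        · simp
        · simp [← hdk]
      rw [← hd']
    rw [hmono]
    exact Submodule.smul_mem _ _ (Submodule.subset_span ⟨⟨d 0, by omega⟩, rfl⟩)
  · rw [Submodule.span_le]
    rintro _ ⟨i, rfl⟩
    exact mono_mem (Nat.lt_succ_iff.mp i.2)

theorem finrank_eq (k : ℕ) : Module.finrank ℂ (binForms k) = k + 1 := by
  rw [eq_span_mono, finrank_span_eq_card (linearIndependent_mono k), Fintype.card_fin]

instance (k : ℕ) : FiniteDimensional ℂ (binForms k) := by
  rw [eq_span_mono]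
  exact FiniteDimensional.span_of_finite ℂ (Set.finite_range _)

theorem exists_eq_sum_mono {k : ℕ} {g : MvPolynomial (Fin 2) ℂ} (hg : g ∈ binForms k) :
    ∃ c : Fin (k + 1) → ℂ, g = ∑ i, c i • mono k i := by
  rw [eq_span_mono] at hg
  obtain ⟨c, hc⟩ := (Submodule.mem_span_range_iff_exists_fun ℂ).mp hg
  exact ⟨c, hc.symm⟩

theorem eval_smul {k : ℕ} {g : MvPolynomial (Fin 2) ℂ} (hg : g ∈ binForms k) (c : ℂ)
    (s : Fin 2 → ℂ) : eval (c • s) g = c ^ k * eval s g := by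
  obtain ⟨a, rfl⟩ := exists_eq_sum_mono hg
  simp only [map_sum, smul_eval, eval_mono, Pi.smul_apply, smul_eq_mul, Finset.mul_sum]
  refine Finset.sum_congr rfl fun i _ => ?_
  have hk : c ^ k = c ^ (i : ℕ) * c ^ (k - i) := by
    rw [← pow_add, Nat.add_sub_cancel' (Nat.lt_succ_iff.mp i.2)]
  rw [hk]
  ring

/-- Multiplication by `g`, as a linear map. -/
abbrev mulBy (g : MvPolynomial (Fin 2) ℂ) :
    MvPolynomial (Fin 2) ℂ →ₗ[ℂ] MvPolynomial (Fin 2) ℂ := LinearMap.mulLeft ℂ g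

theorem finrank_map_mulBy {g : MvPolynomial (Fin 2) ℂ} (hg : g ≠ 0)
    (N : Submodule ℂ (MvPolynomial (Fin 2) ℂ)) :
    Module.finrank ℂ (N.map (mulBy g)) = Module.finrank ℂ N :=
  (Submodule.equivMapOfInjective (mulBy g) (mul_right_injective₀ hg) N).finrank_eq.symm

theorem exists_mem_eval_eq_one (k : ℕ) {s : Fin 2 → ℂ} (hs : s ≠ 0) :
    ∃ g ∈ binForms k, eval s g = 1 := by
  by_cases h0 : s 0 = 0
  · have h1 : s 1 ≠ 0 := fun h1 => hs (by funext i; fin_cases i <;> simp_all)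
    refine ⟨(s 1 ^ k)⁻¹ • mono k 0, Submodule.smul_mem _ _ (mono_mem (Nat.zero_le _)), ?_⟩
    simp [smul_eval, eval_mono, h1]
  · refine ⟨(s 0 ^ k)⁻¹ • mono k k, Submodule.smul_mem _ _ (mono_mem le_rfl), ?_⟩
    simp [smul_eval, eval_mono, h0]

end binForms

namespace binForms

open MvPolynomial

theorem exists_eq_lin_mul {k : ℕ} {g : MvPolynomial (Fin 2) ℂ} (hg : g ∈ binForms (k + 1))
    {s : Fin 2 → ℂ} (hs : s ≠ 0) (h : eval s g = 0) : ∃ h ∈ binForms k, g = lin s * h := by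
  set U : Submodule ℂ (MvPolynomial (Fin 2) ℂ) :=
    binForms (k + 1) ⊓ LinearMap.ker (aeval s : MvPolynomial (Fin 2) ℂ →ₐ[ℂ] ℂ).toLinearMap
  have hmem : ∀ p, p ∈ U ↔ p ∈ binForms (k + 1) ∧ eval s p = 0 := by
    intro p
    simp [U, aeval_eq_eval]
  have hle : (binForms k).map (mulBy (lin s)) ≤ U := by
    rintro _ ⟨p, hp, rfl⟩
    rw [hmem]
    refine ⟨?_, by simp [eval_lin_self]⟩
    rw [add_comm k 1]
    exact mul_mem (lin_mem s) hp
  have hlt : U < binForms (k + 1) := by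
    refine lt_of_le_of_ne inf_le_left fun heq => ?_
    obtain ⟨p, hp, hp1⟩ := exists_mem_eval_eq_one (k + 1) hs
    rw [← heq, hmem] at hp
    exact one_ne_zero (hp1.symm.trans hp.2)
  have hfin : FiniteDimensional ℂ U := Submodule.finiteDimensional_of_le hlt.le
  have hrank := Submodule.finrank_lt_finrank_of_lt hlt
  rw [finrank_eq] at hrank
  have heq : (binForms k).map (mulBy (lin s)) = U := by
    apply Submodule.eq_of_le_of_finrank_le hle
    rw [finrank_map_mulBy (lin_ne_zero hs), finrank_eq]
    omega
  obtain ⟨p, hp, hpg⟩ := heq.symm.le ((hmem g).mpr ⟨hg, h⟩)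
  exact ⟨p, hp, hpg.symm⟩

theorem exists_root {k : ℕ} {g : MvPolynomial (Fin 2) ℂ} (hg : g ∈ binForms (k + 1)) :
    ∃ s : Fin 2 → ℂ, s ≠ 0 ∧ eval s g = 0 := by
  set p : Polynomial ℂ := aeval (fun j : Fin 2 => if j = 0 then Polynomial.X else 1) g
  have heval : ∀ u : ℂ, p.eval u = eval ![u, 1] g := by
    intro u
    obtain ⟨c, hc⟩ := exists_eq_sum_mono hg
    simp only [p, hc, map_sum, map_smul, smul_eval, eval_mono, Polynomial.eval_finsetSum]
    simp [mono]
  by_cases hdeg : p.degree = 0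
  · refine ⟨![1, 0], by simp, ?_⟩
    have hpc := Polynomial.eq_C_of_degree_eq_zero hdeg
    have hmono : mono (k + 1) 0 ∈ binForms (k + 1) := mono_mem (Nat.zero_le _)
    have hzero : X 1 * (g - p.coeff 0 • mono (k + 1) 0) = 0 := by
      apply MvPolynomial.funext
      intro t
      by_cases ht : t 1 = 0
      · simp [ht]
      · have hts : t = t 1 • ![t 0 / t 1, 1] := by
          funext i
          fin_cases i <;> simp
          field_simp
        rw [map_mul, map_sub, smul_eval, hts, eval_smul hg, eval_smul hmono, ← heval, hpc]
        simp [eval_mono]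
        right
        ring
    rw [mul_eq_zero, or_iff_right (X_ne_zero _), sub_eq_zero] at hzero
    rw [hzero, smul_eval, eval_mono]
    simp
  · obtain ⟨u, hu⟩ := IsAlgClosed.exists_root p hdeg
    refine ⟨![u, 1], by simp, ?_⟩
    rw [← heval]
    exact hu

theorem exists_lin_dvd {k : ℕ} {g : MvPolynomial (Fin 2) ℂ} (hg : g ∈ binForms (k + 1)) :
    ∃ s : Fin 2 → ℂ, s ≠ 0 ∧ ∃ h ∈ binForms k, g = lin s * h := by
  obtain ⟨s, hs, hsg⟩ := exists_root hg
  exact ⟨s, hs, exists_eq_lin_mul hg hs hsg⟩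

theorem eq_C_of_mem_zero {g : MvPolynomial (Fin 2) ℂ} (hg : g ∈ binForms 0) :
    ∃ c : ℂ, g = C c := by
  obtain ⟨c, hc⟩ := exists_eq_sum_mono hg
  exact ⟨c 0, by rw [hc]; simp [mono, smul_eq_C_mul]⟩

/-- A nonzero binary form of degree `k` has at most `k` roots on the projective line. -/
theorem exists_roots {k : ℕ} {g : MvPolynomial (Fin 2) ℂ} (hg : g ∈ binForms k) (hg0 : g ≠ 0) :
    ∃ a : Fin k → Fin 2 → ℂ, (∀ i, a i ≠ 0) ∧
      ∀ s, eval s g = 0 → ∃ i, ∃ c : ℂ, s = c • a i := by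
  induction k generalizing g with
  | zero =>
    obtain ⟨c, rfl⟩ := eq_C_of_mem_zero hg
    refine ⟨Fin.elim0, fun i => i.elim0, fun s hs => ?_⟩
    rw [eval_C] at hs
    exact absurd (by rw [hs, C_0]) hg0
  | succ k ih =>
    obtain ⟨b, hb, h, hh, rfl⟩ := exists_lin_dvd hg
    obtain ⟨a, ha0, ha⟩ := ih hh (right_ne_zero_of_mul hg0)
    refine ⟨Fin.cons b a, Fin.cases hb ha0, fun s hs => ?_⟩
    rw [map_mul, mul_eq_zero] at hs
    rcases hs with hs | hs
    · exact ⟨0, exists_smul_of_eval_lin_eq_zero hb hs⟩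
    · obtain ⟨i, hi⟩ := ha s hs
      exact ⟨i.succ, hi⟩

/-- If `Q` divides `ω * H` and `ω` does not vanish at any root of `Q`, then `Q` divides `H`. -/
theorem exists_eq_mul_of_dvd_mul {k j : ℕ} {Q ω H : MvPolynomial (Fin 2) ℂ}
    (hQ : Q ∈ binForms k) (hQ0 : Q ≠ 0) (hω : ∀ s, s ≠ 0 → eval s Q = 0 → eval s ω ≠ 0)
    (hH : H ∈ binForms (k + j)) (hdvd : Q ∣ ω * H) : ∃ h ∈ binForms j, H = Q * h := by
  induction k generalizing Q H with
  | zero =>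
    obtain ⟨c, rfl⟩ := eq_C_of_mem_zero hQ
    have hc : c ≠ 0 := fun hc => hQ0 (by rw [hc, C_0])
    refine ⟨C c⁻¹ * H, ?_, ?_⟩
    · rw [zero_add] at hH
      exact IsHomogeneous.C_mul hH _
    · rw [← mul_assoc, ← C_mul, mul_inv_cancel₀ hc, C_1, one_mul]
  | succ k ih =>
    obtain ⟨b, hb, Q', hQ', rfl⟩ := exists_lin_dvd hQ
    have hHb : eval b H = 0 := by
      obtain ⟨u, hu⟩ := hdvd
      have hb' : eval b (lin b * Q') = 0 := by rw [map_mul, eval_lin_self, zero_mul]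
      have := congrArg (eval b) hu
      rw [map_mul, map_mul, hb', zero_mul, mul_eq_zero] at this
      exact this.resolve_left (hω b hb hb')
    obtain ⟨H', hH', rfl⟩ :=
      exists_eq_lin_mul (k := k + j) (by rwa [add_right_comm] at hH) hb hHb
    obtain ⟨h, hh, rfl⟩ := ih hQ' (right_ne_zero_of_mul hQ0)
      (fun s hs hs' => hω s hs (by rw [map_mul, hs', mul_zero])) hH' (by
        rw [mul_left_comm] at hdvd
        exact (mul_dvd_mul_iff_left (lin_ne_zero hb)).mp hdvd)
    exact ⟨h, hh, by ring⟩

/-- The forms `g` of degree `j` such that all multiples of `g` of degree `j + i` lie in `W`. -/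
def colon (W : Submodule ℂ (MvPolynomial (Fin 2) ℂ)) (j i : ℕ) :
    Submodule ℂ (MvPolynomial (Fin 2) ℂ) where
  carrier := {g | g ∈ binForms j ∧ ∀ h ∈ binForms i, g * h ∈ W}
  add_mem' := fun ha hb => ⟨Submodule.add_mem _ ha.1 hb.1, fun h hh => by
    rw [add_mul]; exact W.add_mem (ha.2 h hh) (hb.2 h hh)⟩
  zero_mem' := ⟨Submodule.zero_mem _, fun h _ => by rw [zero_mul]; exact W.zero_mem⟩
  smul_mem' := fun c a ha => ⟨Submodule.smul_mem _ _ ha.1, fun h hh => by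
    rw [smul_mul_assoc]; exact W.smul_mem _ (ha.2 h hh)⟩

instance (W : Submodule ℂ (MvPolynomial (Fin 2) ℂ)) (j i : ℕ) :
    FiniteDimensional ℂ (colon W j i) :=
  Submodule.finiteDimensional_of_le (S₂ := binForms j) fun _ hg => hg.1

theorem X_mem (i : Fin 2) : (X i : MvPolynomial (Fin 2) ℂ) ∈ binForms 1 := isHomogeneous_X _ _

theorem exists_eq_X_mul_add {k : ℕ} {g : MvPolynomial (Fin 2) ℂ} (hg : g ∈ binForms (k + 1)) :
    ∃ a ∈ binForms k, ∃ b ∈ binForms k, g = X 0 * a + X 1 * b := by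
  have hmono : mono (k + 1) 0 ∈ binForms (k + 1) := mono_mem (Nat.zero_le _)
  have hsub : g - eval ![0, 1] g • mono (k + 1) 0 ∈ binForms (k + 1) :=
    Submodule.sub_mem _ hg (Submodule.smul_mem _ _ hmono)
  obtain ⟨a, ha, hga⟩ := exists_eq_lin_mul hsub (s := ![0, 1]) (by simp)
    (by simp [smul_eval, eval_mono])
  refine ⟨a, ha, eval ![0, 1] g • mono k 0,
    Submodule.smul_mem _ _ (mono_mem (Nat.zero_le _)), ?_⟩
  rw [sub_eq_iff_eq_add] at hga
  nth_rewrite 1 [hga]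
  simp [lin, mono, pow_succ, mul_comm]

/-- The dimensions of the spaces `colon W j i`, with `j + i` fixed, form a convex sequence. -/
theorem finrank_colon_convex (W : Submodule ℂ (MvPolynomial (Fin 2) ℂ)) (j i : ℕ) :
    2 * Module.finrank ℂ (colon W (j + 1) (i + 1)) ≤
      Module.finrank ℂ (colon W j (i + 2)) + Module.finrank ℂ (colon W (j + 2) i) := by
  set N := colon W (j + 1) (i + 1)
  have hX : ∀ t : Fin 2, N.map (mulBy (X t)) ≤ colon W (j + 2) i := by
    rintro t _ ⟨g, hg, rfl⟩
    refine ⟨?_, fun h hh => ?_⟩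
    · have := mul_mem (X_mem t) hg.1
      rwa [add_comm 1 (j + 1)] at this
    · have := hg.2 (X t * h) (by rw [add_comm i 1]; exact mul_mem (X_mem t) hh)
      rwa [mul_left_comm, ← mul_assoc] at this
  have hsup : Module.finrank ℂ ↥(N.map (mulBy (X 0)) ⊔ N.map (mulBy (X 1))) ≤
      Module.finrank ℂ (colon W (j + 2) i) :=
    Submodule.finrank_mono (sup_le (hX 0) (hX 1))
  have hinf : N.map (mulBy (X 0)) ⊓ N.map (mulBy (X 1)) ≤
      (colon W j (i + 2)).map (mulBy (X 0 * X 1)) := by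
    rintro _ ⟨⟨a, ha, rfl⟩, ⟨b, hb, hab⟩⟩
    simp only [LinearMap.mulLeft_apply] at hab
    obtain ⟨c, hc, hac⟩ := exists_eq_lin_mul ha.1 (s := ![1, 0]) (by simp) (by
      have := congrArg (eval ![1, 0]) hab
      simpa using this.symm)
    have hac' : a = X 1 * -c := by rw [hac]; simp [lin]
    have hbc : b = X 0 * -c := by
      apply mul_left_cancel₀ (X_ne_zero (R := ℂ) (1 : Fin 2))
      rw [hab, hac']
      ring
    refine ⟨-c, ⟨Submodule.neg_mem _ hc, fun h hh => ?_⟩, ?_⟩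
    · obtain ⟨u, hu, v, hv, rfl⟩ := exists_eq_X_mul_add hh
      have : -c * (X 0 * u + X 1 * v) = b * u + a * v := by rw [hac', hbc]; ring
      rw [this]
      exact W.add_mem (hb.2 u hu) (ha.2 v hv)
    · simp only [LinearMap.mulLeft_apply]
      rw [hac']
      ring
  have hinf' := Submodule.finrank_mono hinf
  rw [finrank_map_mulBy (mul_ne_zero (X_ne_zero _) (X_ne_zero _))] at hinf'
  have hsum := Submodule.finrank_sup_add_finrank_inf_eq (N.map (mulBy (X 0)))
    (N.map (mulBy (X 1)))
  rw [finrank_map_mulBy (X_ne_zero _), finrank_map_mulBy (X_ne_zero _)] at hsum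
  omega

end binForms

theorem convex_growth {d : ℕ → ℕ} {k : ℕ} (hd : ∀ j, j + 2 ≤ k → 2 * d (j + 1) ≤ d j + d (j + 2))
    {i : ℕ} (hi : d i + 2 ≤ d (i + 1)) : ∀ j, i + j ≤ k → d i + 2 * j ≤ d (i + j) := by
  have hstep : ∀ j, i + j + 1 ≤ k → d (i + j) + 2 ≤ d (i + j + 1) := by
    intro j
    induction j with
    | zero => exact fun _ => hi
    | succ j ih =>
      intro hj
      have h1 := ih (by omega)
      have h2 := hd (i + j) (by omega)
      have e : i + (j + 1) = i + j + 1 := by omega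
      rw [e]
      have e2 : i + j + 1 + 1 = i + j + 2 := by omega
      rw [e2]
      omega
  intro j
  induction j with
  | zero => simp
  | succ j ih =>
    intro hj
    have h1 := ih (by omega)
    have h2 := hstep j (by omega)
    rw [← add_assoc]
    omega

open MvPolynomial in
/-- First order Taylor expansion of a multivariate polynomial. -/
theorem sq_dvd_aeval_add_mul_sub {σ A : Type*} [Fintype σ] [CommRing A] [Algebra ℂ A]
    (f : MvPolynomial σ ℂ) (v w : σ → A) (ε : A) :
    ε ^ 2 ∣ aeval (fun i => v i + ε * w i) f - aeval v f
      - ε * ∑ i, w i * aeval v (pderiv i f) := by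
  induction f using MvPolynomial.induction_on with
  | C a => simp
  | add p q hp hq =>
    have := dvd_add hp hq
    simp only [map_add, mul_add, Finset.sum_add_distrib]
    convert this using 1
    ring
  | mul_X p n hp =>
    have hsum : ∑ i, w i * aeval v (pderiv i (p * X n)) =
        (∑ i, w i * aeval v (pderiv i p)) * v n + w n * aeval v p := by
      have : ∀ i, w i * aeval v (pderiv i (p * X n)) =
          w i * aeval v (pderiv i p) * v n + if i = n then w n * aeval v p else 0 := by
        intro i
        rw [Derivation.leibniz, pderiv_X]
        by_cases h : i = n
        · subst h
          simp
          ring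
        · simp [h]
          ring
      rw [Finset.sum_congr rfl fun i _ => this i, Finset.sum_add_distrib, Finset.sum_mul]
      simp
    rw [hsum, map_mul, map_mul, aeval_X, aeval_X]
    have h1 := hp.mul_right (v n + ε * w n)
    have h2 : ε ^ 2 ∣ ε ^ 2 * ((∑ i, w i * aeval v (pderiv i p)) * w n) := dvd_mul_right _ _
    convert dvd_add h1 h2 using 1
    ring

open MvPolynomial in
theorem aeval_C_mul_of_isHomogeneous {N e : ℕ} {f : MvPolynomial (Fin N) ℂ}
    (hf : f.IsHomogeneous e) (x : Fin N → ℂ) (ω : MvPolynomial (Fin 2) ℂ) :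
    aeval (fun i => C (x i) * ω) f = ω ^ e * C (eval x f) := by
  rw [aeval_def, eval₂_eq', eval_eq', map_sum, Finset.mul_sum]
  refine Finset.sum_congr rfl fun d hd => ?_
  have he : e = ∑ i, d i := by
    rw [IsHomogeneous.degree_eq_sum_deg_support hf hd, ← Finsupp.degree_apply,
      Finsupp.degree_eq_sum]
  simp only [mul_pow, Finset.prod_mul_distrib, Finset.prod_pow_eq_pow_sum, ← he, C_mul, map_prod,
    C_pow, MvPolynomial.algebraMap_eq]
  ring

open MvPolynomial in
/-- If `r = x ω + Q h` and the form `f` vanishes at `r` and at `x`, then the pull-back of the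
differential of `f` at `x` is `Q` times a form which `Q` divides, up to a power of `ω`. -/
theorem gradient_pullback {N e : ℕ} {f : MvPolynomial (Fin N) ℂ} (hf : f.IsHomogeneous e)
    {r h : Fin N → MvPolynomial (Fin 2) ℂ} {x : Fin N → ℂ} {ω Q : MvPolynomial (Fin 2) ℂ}
    (hr : ∀ i, r i = C (x i) * ω + Q * h i) (hfr : aeval r f = 0) (hfx : eval x f = 0)
    (hQ : Q ≠ 0) :
    ∑ i, eval x (pderiv i f) • r i = Q * ∑ i, eval x (pderiv i f) • h i ∧
      Q ∣ ω ^ (e - 1) * ∑ i, eval x (pderiv i f) • h i := by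
  constructor
  · have heuler : ∑ i, x i * eval x (pderiv i f) = 0 := by
      have := congrArg (eval x) hf.sum_X_mul_pderiv
      simpa [hfx] using this
    have : ∀ i, eval x (pderiv i f) • r i =
        C (x i * eval x (pderiv i f)) * ω + Q * (eval x (pderiv i f) • h i) := by
      intro i
      rw [hr, smul_eq_C_mul, smul_eq_C_mul, C_mul]
      ring
    rw [Finset.sum_congr rfl fun i _ => this i, Finset.sum_add_distrib, ← Finset.sum_mul,
      ← map_sum, heuler, C_0, zero_mul, zero_add, Finset.mul_sum]
  · have hT := sq_dvd_aeval_add_mul_sub f (fun i => C (x i) * ω) h Q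
    have hr' : (fun i => C (x i) * ω + Q * h i) = r := funext fun i => (hr i).symm
    rw [hr', hfr, aeval_C_mul_of_isHomogeneous hf, hfx, C_0, mul_zero, sub_zero, zero_sub,
      dvd_neg, sq, mul_dvd_mul_iff_left hQ] at hT
    convert hT using 1
    rw [Finset.mul_sum]
    refine Finset.sum_congr rfl fun i _ => ?_
    rw [aeval_C_mul_of_isHomogeneous hf.pderiv, smul_eq_C_mul]
    ring

/-- The orthogonal complement with respect to the dot product. -/
def dotPerp {N : ℕ} (K : Submodule ℂ (Fin N → ℂ)) : Submodule ℂ (Fin N → ℂ) :=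
  (K.map (dotProductEquiv ℂ (Fin N)).toLinearMap).dualCoannihilator

theorem mem_dotPerp {N : ℕ} {K : Submodule ℂ (Fin N → ℂ)} {v : Fin N → ℂ} :
    v ∈ dotPerp K ↔ ∀ c ∈ K, ∑ i, c i * v i = 0 := by
  rw [dotPerp, Submodule.mem_dualCoannihilator]
  constructor
  · intro h c hc
    exact h _ ⟨c, hc, rfl⟩
  · rintro h _ ⟨c, hc, rfl⟩
    exact h c hc

theorem finrank_dotPerp {N : ℕ} (K : Submodule ℂ (Fin N → ℂ)) :
    Module.finrank ℂ K + Module.finrank ℂ (dotPerp K) = N := by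
  have := Subspace.finrank_add_finrank_dualCoannihilator_eq
    (K.map (dotProductEquiv ℂ (Fin N)).toLinearMap)
  rw [Module.finrank_fin_fun] at this
  have hmap := (dotProductEquiv ℂ (Fin N)).finrank_map_eq K
  rw [← hmap]
  exact this

/-- A subspace of codimension at most one in `W`, killed by a functional which is not zero on `W`,
is the kernel of this functional on `W`. -/
theorem mem_of_functional_eq_zero {E : Type*} [AddCommGroup E] [Module ℂ E]
    {W U : Submodule ℂ E} [FiniteDimensional ℂ W] (hU : U ≤ W) (φ : E →ₗ[ℂ] ℂ)
    (hφ : ∀ u ∈ U, φ u = 0) {g : E} (hg : g ∈ W) (hg0 : φ g ≠ 0)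
    (hrank : Module.finrank ℂ W ≤ Module.finrank ℂ U + 1) {w : E} (hw : w ∈ W) (hw0 : φ w = 0) :
    w ∈ U := by
  have hle : U ≤ W ⊓ LinearMap.ker φ := le_inf hU hφ
  have hlt : W ⊓ LinearMap.ker φ < W :=
    lt_of_le_of_ne inf_le_left fun heq => hg0 (heq.symm.le hg).2
  have hfin : FiniteDimensional ℂ ↥(W ⊓ LinearMap.ker φ) :=
    Submodule.finiteDimensional_of_le hlt.le
  have := Submodule.finrank_lt_finrank_of_lt hlt
  rw [Submodule.eq_of_le_of_finrank_le hle (by omega)]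
  exact ⟨hw, hw0⟩

/-- Evaluation at a point as a linear functional. -/
abbrev evalLin (s : Fin 2 → ℂ) : MvPolynomial (Fin 2) ℂ →ₗ[ℂ] ℂ :=
  (MvPolynomial.aeval s : MvPolynomial (Fin 2) ℂ →ₐ[ℂ] ℂ).toLinearMap

theorem evalLin_apply (s : Fin 2 → ℂ) (g : MvPolynomial (Fin 2) ℂ) :
    evalLin s g = MvPolynomial.eval s g := by
  simp [MvPolynomial.aeval_eq_eval]

/-- The point of projective space with coordinate vector `r s`. -/
abbrev paramVec {n : ℕ} (r : Fin (n + 1) → MvPolynomial (Fin 2) ℂ) (s : Fin 2 → ℂ) :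
    Fin (n + 1) → ℂ := fun i => MvPolynomial.eval s (r i)

section

variable {n e : ℕ} {r : Fin (n + 1) → MvPolynomial (Fin 2) ℂ} {V : Set (PS ℂ n)}

theorem paramVec_smul (hr : ∀ i, r i ∈ binForms e) (c : ℂ) (s : Fin 2 → ℂ) :
    paramVec r (c • s) = c ^ e • paramVec r s := by
  funext i
  exact binForms.eval_smul (hr i) c s

theorem exists_rep_eq_paramVec_smul (hr : ∀ i, r i ∈ binForms e) (he : 0 < e) {s : Fin 2 → ℂ}
    (hs : paramVec r s ≠ 0) :
    ∃ c : ℂ, c ≠ 0 ∧ (Projectivization.mk ℂ (paramVec r s) hs).rep = paramVec r (c • s) := by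
  obtain ⟨u, hu⟩ := Projectivization.exists_smul_eq_mk_rep ℂ (paramVec r s) hs
  obtain ⟨c, hc⟩ := IsAlgClosed.exists_pow_nat_eq (u : ℂ) he
  refine ⟨c, ?_, ?_⟩
  · rintro rfl
    rw [zero_pow he.ne'] at hc
    exact u.ne_zero hc.symm
  · rw [paramVec_smul hr, hc, ← hu]
    rfl

theorem IsParamOf.mk_mem (h : IsParamOf r V e) {s : Fin 2 → ℂ} (hs : paramVec r s ≠ 0) :
    Projectivization.mk ℂ (paramVec r s) hs ∈ V := by
  rw [h.2.2]
  exact ⟨s, hs, rfl⟩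

theorem IsParamOf.exists_eq_rep (h : IsParamOf r V e) (he : 0 < e) {x : PS ℂ n} (hx : x ∈ V) :
    ∃ s : Fin 2 → ℂ, s ≠ 0 ∧ paramVec r s = x.rep := by
  rw [h.2.2] at hx
  obtain ⟨s, hs, rfl⟩ := hx
  obtain ⟨c, -, hc⟩ := exists_rep_eq_paramVec_smul h.1 he hs
  refine ⟨c • s, ?_, hc.symm⟩
  intro h0
  have := Projectivization.rep_nonzero (Projectivization.mk ℂ (paramVec r s) hs)
  rw [hc, h0] at this
  apply this
  have := paramVec_smul h.1 0 (0 : Fin 2 → ℂ)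
  rwa [smul_zero, zero_pow he.ne', zero_smul] at this

theorem eval_aeval_eq {N : ℕ} (r : Fin N → MvPolynomial (Fin 2) ℂ) (f : MvPolynomial (Fin N) ℂ)
    (s : Fin 2 → ℂ) :
    MvPolynomial.eval s (MvPolynomial.aeval r f) =
      MvPolynomial.eval (fun i => MvPolynomial.eval s (r i)) f := by
  induction f using MvPolynomial.induction_on with
  | C a => simp
  | add p q hp hq => rw [map_add, map_add, map_add, hp, hq]
  | mul_X p n hp => rw [map_mul, map_mul, map_mul, hp, MvPolynomial.aeval_X, MvPolynomial.eval_X]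

theorem IsParamOf.aeval_eq_zero (h : IsParamOf r V e) {f : MvPolynomial (Fin (n + 1)) ℂ}
    (hf : ∀ x ∈ V, ∀ v ∈ x.submodule, MvPolynomial.eval v f = 0) :
    MvPolynomial.aeval r f = 0 := by
  apply MvPolynomial.funext
  intro s
  rw [eval_aeval_eq, map_zero]
  by_cases hs : paramVec r s = 0
  · have h1 : paramVec r ![1, 0] ≠ 0 := h.2.1 _ (by simp)
    refine hf _ (h.mk_mem h1) _ ?_
    rw [show (fun i => MvPolynomial.eval s (r i)) = 0 from hs]
    exact Submodule.zero_mem _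
  · refine hf _ (h.mk_mem hs) _ ?_
    rw [Projectivization.submodule_mk]
    exact Submodule.mem_span_singleton_self _

theorem IsParamOf.eval_eq_zero (h : IsParamOf r V e) (he : 0 < e)
    {f : MvPolynomial (Fin (n + 1)) ℂ} {k : ℕ} (hk : f.IsHomogeneous k)
    (hf : MvPolynomial.aeval r f = 0) :
    ∀ x ∈ V, ∀ v ∈ x.submodule, MvPolynomial.eval v f = 0 := by
  intro x hx v hv
  obtain ⟨s, -, hs⟩ := h.exists_eq_rep he hx
  rw [Projectivization.submodule_eq, Submodule.mem_span_singleton] at hv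
  obtain ⟨c, rfl⟩ := hv
  have h0 : MvPolynomial.eval x.rep f = 0 := by
    rw [← hs, ← eval_aeval_eq, hf, map_zero]
  have := aeval_C_mul_of_isHomogeneous hk x.rep (MvPolynomial.C c)
  rw [h0, MvPolynomial.C_0, mul_zero] at this
  have := congrArg (MvPolynomial.eval 0) this
  rw [eval_aeval_eq, map_zero] at this
  rw [← this]
  congr 2
  funext i
  simp [mul_comm]

theorem mem_tangentSpaceAt {x : PS ℂ n} {v : Fin (n + 1) → ℂ} :
    v ∈ tangentSpaceAt V x ↔ ∀ f ∈ vanishingForms V,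
      ∑ i, MvPolynomial.eval x.rep (MvPolynomial.pderiv i f) * v i = 0 := by
  simp [tangentSpaceAt, Submodule.mem_iInf]

end

/-- The linear map sending the coefficients of a linear form to its pull-back. -/
abbrev pullback {N : ℕ} (r : Fin N → MvPolynomial (Fin 2) ℂ) :
    (Fin N → ℂ) →ₗ[ℂ] MvPolynomial (Fin 2) ℂ := Fintype.linearCombination ℂ r

theorem pullback_apply {N : ℕ} (r : Fin N → MvPolynomial (Fin 2) ℂ) (c : Fin N → ℂ) :
    pullback r c = ∑ i, c i • r i := Fintype.linearCombination_apply ℂ r c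

theorem pullback_injective {N : ℕ} {r : Fin N → MvPolynomial (Fin 2) ℂ}
    (hli : LinearIndependent ℂ r) : Function.Injective (pullback r) :=
  hli.fintypeLinearCombination_injective

theorem range_pullback {N : ℕ} (r : Fin N → MvPolynomial (Fin 2) ℂ) :
    LinearMap.range (pullback r) = Submodule.span ℂ (Set.range r) :=
  Fintype.range_linearCombination ℂ r

/-- The span of the coordinate functions of a smooth rational curve separates points and tangent
directions. -/
theorem not_mul_mem_span_of_smooth {j : ℕ} {r : Fin (j + 3 + 1) → MvPolynomial (Fin 2) ℂ}
    {V : Set (PS ℂ (j + 3))} (h : IsParamOf r V (j + 4)) (hli : LinearIndependent ℂ r)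
    (hV : IsSmoothCurve V) {Q : MvPolynomial (Fin 2) ℂ} (hQ : Q ∈ binForms 2) (hQ0 : Q ≠ 0) :
    ¬ ∀ g ∈ binForms (j + 2), Q * g ∈ Submodule.span ℂ (Set.range r) := by
  intro hspan
  set W := Submodule.span ℂ (Set.range r)
  have hrmem : ∀ i, r i ∈ W := fun i => Submodule.subset_span ⟨i, rfl⟩
  have hWfin : FiniteDimensional ℂ W := FiniteDimensional.span_of_finite ℂ (Set.finite_range r)
  have hWrank : Module.finrank ℂ W = j + 4 := by
    rw [finrank_span_eq_card hli, Fintype.card_fin]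
  obtain ⟨a₀, ha₀, hQa₀⟩ := binForms.exists_root hQ
  have hv₀ : paramVec r a₀ ≠ 0 := h.2.1 a₀ ha₀
  set x := Projectivization.mk ℂ (paramVec r a₀) hv₀
  have hxV : x ∈ V := h.mk_mem hv₀
  obtain ⟨c, hc, hxrep⟩ := exists_rep_eq_paramVec_smul h.1 (by omega) hv₀
  change x.rep = _ at hxrep
  set a := c • a₀
  have hQa : MvPolynomial.eval a Q = 0 := by
    rw [binForms.eval_smul hQ, hQa₀, mul_zero]
  obtain ⟨i₀, hi₀⟩ : ∃ i, x.rep i ≠ 0 := Function.ne_iff.mp x.rep_nonzero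
  set ω := (x.rep i₀)⁻¹ • r i₀
  have hωW : ω ∈ W := W.smul_mem _ (hrmem i₀)
  have hωa : MvPolynomial.eval a ω = 1 := by
    simp only [ω, MvPolynomial.smul_eval]
    rw [show MvPolynomial.eval a (r i₀) = x.rep i₀ from (congrFun hxrep i₀).symm,
      inv_mul_cancel₀ hi₀]
  have hdecomp : ∀ i, ∃ g ∈ binForms (j + 2), r i = MvPolynomial.C (x.rep i) * ω + Q * g := by
    intro i
    have hmem : r i - x.rep i • ω ∈ (binForms (j + 2)).map (binForms.mulBy Q) := by
      refine mem_of_functional_eq_zero (W := W) ?_ (evalLin a) ?_ hωW ?_ ?_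
        (W.sub_mem (hrmem i) (W.smul_mem _ hωW)) ?_
      · rintro _ ⟨g, hg, rfl⟩
        exact hspan g hg
      · rintro _ ⟨g, hg, rfl⟩
        rw [evalLin_apply, LinearMap.mulLeft_apply, map_mul, hQa, zero_mul]
      · rw [evalLin_apply, hωa]
        exact one_ne_zero
      · rw [binForms.finrank_map_mulBy hQ0, binForms.finrank_eq, hWrank]
      · rw [evalLin_apply, map_sub, MvPolynomial.smul_eval, hωa, mul_one, hxrep, sub_self]
    obtain ⟨g, hg, hgi⟩ := hmem
    rw [LinearMap.mulLeft_apply, MvPolynomial.smul_eq_C_mul] at hgi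
    exact ⟨g, hg, by rw [hgi]; ring⟩
  choose g hg hrg using hdecomp
  have hωQ : ∀ s, s ≠ 0 → MvPolynomial.eval s Q = 0 → MvPolynomial.eval s ω ≠ 0 := by
    intro s hs hQs hωs
    apply h.2.1 s hs
    funext i
    simp [hrg i, hQs, hωs]
  set K := ((binForms j).map (binForms.mulBy (Q * Q))).comap (pullback r)
  have hKrank : Module.finrank ℂ K ≤ j + 1 := by
    have h1 := (Submodule.equivMapOfInjective (pullback r) (pullback_injective hli) K).finrank_eq
    have h2 := Submodule.finrank_mono (Submodule.map_comap_le (pullback r)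
      ((binForms j).map (binForms.mulBy (Q * Q))))
    rw [binForms.finrank_map_mulBy (mul_ne_zero hQ0 hQ0), binForms.finrank_eq] at h2
    exact h1.trans_le h2
  have hle : dotPerp K ≤ tangentSpaceAt V x := by
    intro v hv
    rw [mem_tangentSpaceAt]
    rintro f ⟨⟨e, hfe⟩, hfV⟩
    refine mem_dotPerp.mp hv (fun i => MvPolynomial.eval x.rep (MvPolynomial.pderiv i f)) ?_
    obtain ⟨h1, h2⟩ := gradient_pullback hfe hrg (h.aeval_eq_zero hfV)
      (hfV x hxV _ (by
        rw [Projectivization.submodule_eq]; exact Submodule.mem_span_singleton_self _)) hQ0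
    obtain ⟨p, hp, hpeq⟩ := binForms.exists_eq_mul_of_dvd_mul (j := j) hQ hQ0
      (ω := ω ^ (e - 1)) (fun s hs hs' => by
        rw [map_pow]; exact pow_ne_zero _ (hωQ s hs hs'))
      (by
        rw [add_comm 2 j]
        exact Submodule.sum_mem _ fun i _ => Submodule.smul_mem _ _ (hg i)) h2
    refine ⟨p, hp, ?_⟩
    rw [pullback_apply, h1, hpeq, LinearMap.mulLeft_apply, mul_assoc]
  have hrank := Submodule.finrank_mono hle
  rw [(hV x hxV).2] at hrank
  have := finrank_dotPerp K
  omega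

theorem binForms.add_le_mul (k l : ℕ) : binForms (k + l) ≤ binForms k * binForms l := by
  rw [binForms.eq_span_mono (k + l), Submodule.span_le]
  rintro _ ⟨⟨i, hi⟩, rfl⟩
  obtain ⟨a, b, ha, hb, rfl⟩ : ∃ a b, a ≤ k ∧ b ≤ l ∧ i = a + b :=
    ⟨min i k, i - min i k, by omega, by omega, by omega⟩
  simp only [SetLike.mem_coe]
  rw [← binForms.mono_mul_mono ha hb]
  exact Submodule.mul_mem_mul (binForms.mono_mem ha) (binForms.mono_mem hb)

theorem finrank_le_finrank_add_one {E : Type*} [AddCommGroup E] [Module ℂ E]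
    {V N : Submodule ℂ E} [FiniteDimensional ℂ V] [FiniteDimensional ℂ N] (φ : E →ₗ[ℂ] ℂ)
    (h : ∀ v ∈ V, φ v = 0 → v ∈ N) : Module.finrank ℂ V ≤ Module.finrank ℂ N + 1 := by
  have h1 := LinearMap.finrank_range_add_finrank_ker (φ.domRestrict V)
  have h2 := (LinearMap.range (φ.domRestrict V)).finrank_le
  rw [Module.finrank_self] at h2
  have h3 : (LinearMap.ker (φ.domRestrict V)).map V.subtype ≤ N := by
    rintro _ ⟨v, hv, rfl⟩
    exact h _ v.2 hv
  have h4 := Submodule.finrank_mono h3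
  rw [Submodule.finrank_map_subtype_eq] at h4
  omega

/-- A linearly independent system of `k + 2` binary forms of degree `k + 2` whose span separates
points and tangent directions of the projective line. -/
structure IsEmbedding {k : ℕ} (r : Fin (k + 1 + 1) → MvPolynomial (Fin 2) ℂ) : Prop where
  mem : ∀ i, r i ∈ binForms (k + 2)
  linearIndependent : LinearIndependent ℂ r
  separates : ∀ Q ∈ binForms 2, Q ≠ 0 →
    ¬ ∀ g ∈ binForms k, Q * g ∈ Submodule.span ℂ (Set.range r)

namespace IsEmbedding

variable {k : ℕ} {r : Fin (k + 1 + 1) → MvPolynomial (Fin 2) ℂ}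

theorem mem_span (i : Fin (k + 1 + 1)) : r i ∈ Submodule.span ℂ (Set.range r) :=
  Submodule.subset_span ⟨i, rfl⟩

instance : FiniteDimensional ℂ (Submodule.span ℂ (Set.range r)) :=
  FiniteDimensional.span_of_finite ℂ (Set.finite_range r)

theorem span_le (h : IsEmbedding r) : Submodule.span ℂ (Set.range r) ≤ binForms (k + 2) := by
  rw [Submodule.span_le]
  rintro _ ⟨i, rfl⟩
  exact h.mem i

theorem finrank_span (h : IsEmbedding r) :
    Module.finrank ℂ (Submodule.span ℂ (Set.range r)) = k + 2 := by
  rw [finrank_span_eq_card h.linearIndependent, Fintype.card_fin]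

/-- The span of `r` is the kernel, on forms of degree `k + 2`, of every functional vanishing on all
the `r i` but not on all forms. -/
theorem mem_span_of_functional (h : IsEmbedding r) (φ : MvPolynomial (Fin 2) ℂ →ₗ[ℂ] ℂ)
    (hφ : ∀ i, φ (r i) = 0) {g : MvPolynomial (Fin 2) ℂ} (hg : g ∈ binForms (k + 2))
    (hg0 : φ g ≠ 0) {w : MvPolynomial (Fin 2) ℂ} (hw : w ∈ binForms (k + 2)) (hw0 : φ w = 0) :
    w ∈ Submodule.span ℂ (Set.range r) := by
  refine mem_of_functional_eq_zero h.span_le φ ?_ hg hg0 ?_ hw hw0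
  · have : Submodule.span ℂ (Set.range r) ≤ LinearMap.ker φ := by
      rw [Submodule.span_le]
      rintro _ ⟨i, rfl⟩
      exact hφ i
    exact fun u hu => this hu
  · rw [h.finrank_span, binForms.finrank_eq]

theorem exists_sub_smul_mem (h : IsEmbedding r) {z : MvPolynomial (Fin 2) ℂ}
    (hz : z ∈ binForms (k + 2)) (hz0 : z ∉ Submodule.span ℂ (Set.range r))
    {g : MvPolynomial (Fin 2) ℂ} (hg : g ∈ binForms (k + 2)) :
    ∃ c : ℂ, g - c • z ∈ Submodule.span ℂ (Set.range r) := by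
  obtain ⟨φ, hφz, hφ⟩ := Submodule.exists_le_ker_of_notMem hz0
  refine ⟨φ g / φ z, h.mem_span_of_functional φ (fun i => hφ (mem_span i)) hz hφz
    (Submodule.sub_mem _ hg (Submodule.smul_mem _ _ hz)) ?_⟩
  rw [map_sub, map_smul, smul_eq_mul, div_mul_cancel₀ _ hφz, sub_self]

theorem exists_notMem (h : IsEmbedding r) :
    ∃ z ∈ binForms (k + 2), z ∉ Submodule.span ℂ (Set.range r) := by
  by_contra! hcon
  have := Submodule.finrank_mono (show binForms (k + 2) ≤ _ from hcon)
  rw [h.finrank_span, binForms.finrank_eq] at this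
  omega

theorem paramVec_ne_zero (h : IsEmbedding r) {s : Fin 2 → ℂ} (hs : s ≠ 0) : paramVec r s ≠ 0 := by
  intro h0
  obtain ⟨ω, hω, hωs⟩ := binForms.exists_mem_eval_eq_one (k + 2) hs
  refine h.separates (binForms.lin s * binForms.lin s)
    (binForms.mul_mem (binForms.lin_mem s) (binForms.lin_mem s))
    (mul_ne_zero (binForms.lin_ne_zero hs) (binForms.lin_ne_zero hs)) fun g hg => ?_
  refine h.mem_span_of_functional (evalLin s) (fun i => ?_) hω ?_ ?_ ?_
  · rw [evalLin_apply]
    exact congrFun h0 i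
  · rw [evalLin_apply, hωs]
    exact one_ne_zero
  · have := binForms.mul_mem (binForms.mul_mem (binForms.lin_mem s) (binForms.lin_mem s)) hg
    rwa [show 1 + 1 + k = k + 2 by ring] at this
  · rw [evalLin_apply, map_mul, map_mul, binForms.eval_lin_self, zero_mul, zero_mul]

theorem exists_smul_eq (h : IsEmbedding r) {s t : Fin 2 → ℂ} (hs : s ≠ 0) (ht : t ≠ 0) {c : ℂ}
    (hc : paramVec r s = c • paramVec r t) : ∃ a : ℂ, s = a • t := by
  by_contra hcon
  have hts : MvPolynomial.eval s (binForms.lin t) ≠ 0 := fun h0 =>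
    hcon (binForms.exists_smul_of_eval_lin_eq_zero ht h0)
  obtain ⟨ω, hω, hωs⟩ := binForms.exists_mem_eval_eq_one (k + 1) hs
  refine h.separates (binForms.lin s * binForms.lin t)
    (binForms.mul_mem (binForms.lin_mem s) (binForms.lin_mem t))
    (mul_ne_zero (binForms.lin_ne_zero hs) (binForms.lin_ne_zero ht)) fun g hg => ?_
  refine h.mem_span_of_functional (evalLin s - c • evalLin t) (fun i => ?_)
    (g := binForms.lin t * ω) ?_ ?_ ?_ ?_
  · rw [LinearMap.sub_apply, LinearMap.smul_apply, evalLin_apply, evalLin_apply, sub_eq_zero]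
    exact congrFun hc i
  · have := binForms.mul_mem (binForms.lin_mem t) hω
    rwa [show 1 + (k + 1) = k + 2 by ring] at this
  · rw [LinearMap.sub_apply, LinearMap.smul_apply, evalLin_apply, evalLin_apply, map_mul, map_mul,
      hωs, binForms.eval_lin_self]
    simpa using hts
  · have := binForms.mul_mem (binForms.mul_mem (binForms.lin_mem s) (binForms.lin_mem t)) hg
    rwa [show 1 + 1 + k = k + 2 by ring] at this
  · rw [LinearMap.sub_apply, LinearMap.smul_apply, evalLin_apply, evalLin_apply, map_mul, map_mul,
      map_mul, map_mul, binForms.eval_lin_self, binForms.eval_lin_self]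
    simp

/-- Binary forms of twice the degree are sums of products of elements of the span of `r`. -/
theorem le_span_mul_span (h : IsEmbedding r) :
    binForms (k + 2 + (k + 2)) ≤
      Submodule.span ℂ (Set.range r) * Submodule.span ℂ (Set.range r) := by
  intro A hA
  by_contra hAV
  set V := Submodule.span ℂ (Set.range r)
  set m := k + 2 with hm
  obtain ⟨μ, hμA, hμ⟩ := Submodule.exists_le_ker_of_notMem hAV
  set d : ℕ → ℕ := fun j =>
    Module.finrank ℂ (binForms.colon (LinearMap.ker μ) j (m + m - j)) with hd
  have hconv : ∀ j, j + 2 ≤ m + m → 2 * d (j + 1) ≤ d j + d (j + 2) := by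
    intro j hj
    have := binForms.finrank_colon_convex (LinearMap.ker μ) j (m + m - (j + 2))
    rwa [show m + m - (j + 2) + 1 = m + m - (j + 1) by omega,
      show m + m - (j + 2) + 2 = m + m - j by omega] at this
  have htop : d (m + m) ≤ m + m := by
    have hlt : binForms.colon (LinearMap.ker μ) (m + m) (m + m - (m + m)) < binForms (m + m) := by
      refine lt_of_le_of_ne (fun _ hg => hg.1) fun heq => hμA ?_
      have := (heq.symm.le hA).2 1 (by
        rw [Nat.sub_self]
        exact MvPolynomial.isHomogeneous_one _ _)
      rwa [mul_one] at this
    have := Submodule.finrank_lt_finrank_of_lt hlt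
    rw [binForms.finrank_eq] at this
    exact Nat.lt_succ_iff.mp this
  obtain ⟨z, hz, hzV⟩ := h.exists_notMem
  have hmid : k + 1 ≤ d m := by
    have := finrank_le_finrank_add_one (V := V)
      (N := binForms.colon (LinearMap.ker μ) m (m + m - m)) (μ ∘ₗ binForms.mulBy z) ?_
    · rw [h.finrank_span] at this
      exact Nat.le_of_succ_le_succ this
    · intro v hv hvz
      refine ⟨h.span_le hv, fun g hg => ?_⟩
      rw [Nat.add_sub_cancel] at hg
      obtain ⟨c, hc⟩ := h.exists_sub_smul_mem hz hzV hg
      have h1 := hμ (Submodule.mul_mem_mul hv hc)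
      rw [LinearMap.mem_ker] at h1 ⊢
      rw [LinearMap.comp_apply, LinearMap.mulLeft_apply, mul_comm] at hvz
      rwa [mul_sub, map_sub, mul_smul_comm, map_smul, hvz, smul_zero, sub_zero] at h1
  have htwo : d 2 ≠ 0 := by
    intro h2
    by_cases hstep : ∃ i, i < m ∧ d i + 2 ≤ d (i + 1)
    · obtain ⟨i, hi, hdi⟩ := hstep
      have := convex_growth hconv hdi (m + m - i) (by omega)
      rw [show i + (m + m - i) = m + m by omega] at this
      omega
    · push Not at hstep
      have hind : ∀ t, t ≤ k → d (2 + t) ≤ t := by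
        intro t
        induction t with
        | zero => intro _; exact h2.le
        | succ t ih =>
          intro ht
          have h1 := ih (by omega)
          have h2 := hstep (2 + t) (by omega)
          rw [show 2 + (t + 1) = 2 + t + 1 by ring]
          omega
      have := hind k le_rfl
      rw [add_comm 2 k, ← hm] at this
      omega
  have hbot : binForms.colon (LinearMap.ker μ) 2 (m + m - 2) ≠ ⊥ := fun hbot =>
    htwo (by simp only [hd]; rw [hbot, finrank_bot])
  obtain ⟨Q, hQ, hQ0⟩ := Submodule.exists_mem_ne_zero_of_ne_bot hbot
  refine h.separates Q hQ.1 hQ0 fun g hg => ?_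
  by_contra hQg
  have hQgmem : Q * g ∈ binForms (k + 2) := by
    rw [add_comm]
    exact binForms.mul_mem hQ.1 hg
  have hkill : ∀ f ∈ binForms m, μ (Q * g * f) = 0 := by
    intro f hf
    rw [mul_assoc]
    refine hQ.2 _ ?_
    rw [show m + m - 2 = k + m by omega]
    exact binForms.mul_mem hg hf
  apply hμA
  refine Submodule.mul_induction_on (binForms.add_le_mul m m hA) (fun f hf f' hf' => ?_)
    fun x y hx hy => by rw [map_add, hx, hy, add_zero]
  obtain ⟨c, hc⟩ := h.exists_sub_smul_mem hQgmem hQg hf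
  obtain ⟨c', hc'⟩ := h.exists_sub_smul_mem hQgmem hQg hf'
  have h1 := hμ (Submodule.mul_mem_mul hc hc')
  rw [LinearMap.mem_ker] at h1
  have h2 : f * f' = (f - c • (Q * g)) * (f' - c' • (Q * g)) + c • (Q * g * (f' - c' • (Q * g)))
      + c' • (Q * g * f) := by
    simp only [MvPolynomial.smul_eq_C_mul]
    ring
  rw [h2, map_add, map_add, h1, map_smul, map_smul, hkill _ hf,
    hkill _ (h.span_le hc'), smul_zero, smul_zero, add_zero, add_zero]

theorem exists_aeval_eq (h : IsEmbedding r) {A : MvPolynomial (Fin 2) ℂ}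
    (hA : A ∈ binForms (k + 2 + (k + 2))) :
    ∃ P : MvPolynomial (Fin (k + 1 + 1)) ℂ, P.IsHomogeneous 2 ∧ MvPolynomial.aeval r P = A := by
  have hlin : ∀ v ∈ Submodule.span ℂ (Set.range r),
      ∃ P : MvPolynomial (Fin (k + 1 + 1)) ℂ, P.IsHomogeneous 1 ∧ MvPolynomial.aeval r P = v := by
    intro v hv
    obtain ⟨c, rfl⟩ := (Submodule.mem_span_range_iff_exists_fun ℂ).mp hv
    exact ⟨∑ i, c i • MvPolynomial.X i,
      Submodule.sum_mem (MvPolynomial.homogeneousSubmodule _ ℂ 1) fun i _ =>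
        Submodule.smul_mem _ _ (MvPolynomial.isHomogeneous_X _ _), by
      simp only [map_sum, map_smul, MvPolynomial.aeval_X]⟩
  refine Submodule.mul_induction_on (h.le_span_mul_span hA) (fun f hf f' hf' => ?_)
    fun x y hx hy => ?_
  · obtain ⟨P, hP, rfl⟩ := hlin f hf
    obtain ⟨P', hP', rfl⟩ := hlin f' hf'
    exact ⟨P * P', hP.mul hP', map_mul _ _ _⟩
  · obtain ⟨P, hP, rfl⟩ := hx
    obtain ⟨P', hP', rfl⟩ := hy
    exact ⟨P + P', hP.add hP', map_add _ _ _⟩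

end IsEmbedding

/-- A point satisfying the equations of the rational normal curve lies on it. -/
theorem exists_eq_pow_mul_pow {M : ℕ} (hM : 0 < M) {z : ℕ → ℂ}
    (hz : ∀ i j k l, i ≤ M → j ≤ M → k ≤ M → l ≤ M → i + j = k + l → z i * z j = z k * z l) :
    ∃ s : Fin 2 → ℂ, ∀ i, i ≤ M → z i = s 0 ^ i * s 1 ^ (M - i) := by
  by_cases h0 : z 0 = 0
  · have hzero : ∀ i, i < M → z i = 0 := by
      intro i
      induction i with
      | zero => exact fun _ => h0
      | succ i ih =>
        intro hi
        have := hz (i + 1) (i + 1) i (i + 2) (by omega) (by omega) (by omega) (by omega) (by omega)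
        rw [ih (by omega), zero_mul] at this
        exact mul_self_eq_zero.mp this
    obtain ⟨c, hc⟩ := IsAlgClosed.exists_pow_nat_eq (z M) hM
    refine ⟨![c, 0], fun i hi => ?_⟩
    obtain rfl | hlt := hi.eq_or_lt
    · simp [hc]
    · have : M - i ≠ 0 := by omega
      simp [hzero i hlt, this]
  · obtain ⟨c, hc⟩ := IsAlgClosed.exists_pow_nat_eq (z 0) hM
    have hpow : ∀ i, i ≤ M → z i = z 0 * (z 1 / z 0) ^ i := by
      intro i
      induction i with
      | zero => intro _; simp
      | succ i ih =>
        intro hi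
        have := hz (i + 1) 0 i 1 (by omega) (by omega) (by omega) (by omega) (by omega)
        rw [ih (by omega)] at this
        apply mul_right_cancel₀ h0
        rw [this, pow_succ]
        field_simp
    refine ⟨![c * (z 1 / z 0), c], fun i hi => ?_⟩
    rw [hpow i hi]
    simp only [Matrix.cons_val_zero, Matrix.cons_val_one, mul_pow]
    rw [mul_right_comm, ← pow_add, Nat.add_sub_cancel' hi, hc]

namespace IsEmbedding

variable {k : ℕ} {r : Fin (k + 1 + 1) → MvPolynomial (Fin 2) ℂ} {V : Set (PS ℂ (k + 1))}

theorem isAlg (h : IsEmbedding r) (hV : IsParamOf r V (k + 2)) : IsAlg V := by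
  refine ⟨vanishingForms V, fun f hf => hf.1, Set.Subset.antisymm
    (fun x hx f hf => hf.2 x hx) fun x hx => ?_⟩
  set v := x.rep
  have hvx : v ∈ x.submodule := by
    rw [Projectivization.submodule_eq]
    exact Submodule.mem_span_singleton_self _
  have hvan : ∀ (f : MvPolynomial (Fin (k + 1 + 1)) ℂ) (e : ℕ), f.IsHomogeneous e →
      MvPolynomial.aeval r f = 0 → MvPolynomial.eval v f = 0 := fun f e hf hfr =>
    hx f ⟨⟨e, hf⟩, hV.eval_eq_zero (by omega) hf hfr⟩ v hvx
  have hP : ∀ i, ∃ P : MvPolynomial (Fin (k + 1 + 1)) ℂ, P.IsHomogeneous 2 ∧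
      (i ≤ k + 2 + (k + 2) → MvPolynomial.aeval r P = binForms.mono (k + 2 + (k + 2)) i) := by
    intro i
    by_cases hi : i ≤ k + 2 + (k + 2)
    · obtain ⟨P, hP, hPr⟩ := h.exists_aeval_eq (binForms.mono_mem hi)
      exact ⟨P, hP, fun _ => hPr⟩
    · exact ⟨0, MvPolynomial.isHomogeneous_zero _ _ _, fun hi' => absurd hi' hi⟩
  choose P hPhom hPr using hP
  obtain ⟨s, hs⟩ := exists_eq_pow_mul_pow (M := k + 2 + (k + 2)) (by omega)
    (z := fun i => MvPolynomial.eval v (P i)) (by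
      intro i j a b hi hj ha hb hij
      have := hvan (P i * P j - P a * P b) (2 + 2)
        (((hPhom i).mul (hPhom j)).sub ((hPhom a).mul (hPhom b))) (by
          rw [map_sub, map_mul, map_mul, hPr i hi, hPr j hj, hPr a ha, hPr b hb,
            binForms.mono_mul_mono hi hj, binForms.mono_mul_mono ha hb, hij, sub_self])
      rwa [map_sub, map_mul, map_mul, sub_eq_zero] at this)
  have hprod : ∀ a b, v a * v b = MvPolynomial.eval s (r a) * MvPolynomial.eval s (r b) := by
    intro a b
    obtain ⟨c, hc⟩ := binForms.exists_eq_sum_mono (binForms.mul_mem (h.mem a) (h.mem b))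
    have := hvan (MvPolynomial.X a * MvPolynomial.X b - ∑ i, c i • P i) 2
      (((MvPolynomial.isHomogeneous_X _ _).mul (MvPolynomial.isHomogeneous_X _ _)).sub
        (Submodule.sum_mem (MvPolynomial.homogeneousSubmodule _ ℂ 2) fun i _ =>
          Submodule.smul_mem _ _ (hPhom i))) (by
        rw [map_sub, map_mul, MvPolynomial.aeval_X, MvPolynomial.aeval_X, hc, map_sum, sub_eq_zero]
        refine Finset.sum_congr rfl fun i _ => ?_
        rw [map_smul, hPr i (Nat.lt_succ_iff.mp i.2)])
    rw [map_sub, map_mul, MvPolynomial.eval_X, MvPolynomial.eval_X, sub_eq_zero] at this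
    rw [this, ← map_mul, hc, map_sum, map_sum]
    refine Finset.sum_congr rfl fun i _ => ?_
    rw [MvPolynomial.smul_eval, MvPolynomial.smul_eval, binForms.eval_mono]
    congr 1
    exact hs i (Nat.lt_succ_iff.mp i.2)
  obtain ⟨a, ha⟩ : ∃ i, v i ≠ 0 := Function.ne_iff.mp x.rep_nonzero
  have hra : MvPolynomial.eval s (r a) ≠ 0 := by
    intro h0
    have := hprod a a
    rw [h0, mul_zero] at this
    exact ha (mul_self_eq_zero.mp this)
  rw [hV.2.2]
  refine ⟨s, fun h0 => hra (congrFun h0 a), ?_⟩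
  rw [← Projectivization.mk_rep x, Projectivization.mk_eq_mk_iff']
  refine ⟨MvPolynomial.eval s (r a) / v a, ?_⟩
  funext b
  have := hprod a b
  rw [Pi.smul_apply, smul_eq_mul, div_mul_eq_mul_div, ← this, mul_div_cancel_left₀ _ ha]

theorem isSmoothCurve (h : IsEmbedding r) (hV : IsParamOf r V (k + 2)) : IsSmoothCurve V := by
  intro x hx
  refine ⟨hx, ?_⟩
  obtain ⟨s, hs, hsx⟩ := hV.exists_eq_rep (by omega) hx
  set Q := binForms.lin s
  have hQ : Q ∈ binForms 1 := binForms.lin_mem s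
  have hQ0 : Q ≠ 0 := binForms.lin_ne_zero hs
  have hQQ0 : Q * Q ≠ 0 := mul_ne_zero hQ0 hQ0
  have hQs : MvPolynomial.eval s Q = 0 := binForms.eval_lin_self s
  have hreps : ∀ i, MvPolynomial.eval s (r i) = x.rep i := congrFun hsx
  set N := (binForms k).map (binForms.mulBy (Q * Q))
  have hNmem : N ≤ binForms (k + 2) := by
    rintro _ ⟨g, hg, rfl⟩
    rw [add_comm]
    exact binForms.mul_mem (binForms.mul_mem hQ hQ) hg
  have hNrank : Module.finrank ℂ N = k + 1 := by
    rw [binForms.finrank_map_mulBy hQQ0, binForms.finrank_eq]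
  set K := N.comap (pullback r)
  have hKmap : K.map (pullback r) = Submodule.span ℂ (Set.range r) ⊓ N := by
    rw [Submodule.map_comap_eq, range_pullback]
  have hKrank : Module.finrank ℂ K = k := by
    rw [(Submodule.equivMapOfInjective (pullback r)
      (pullback_injective h.linearIndependent) K).finrank_eq, hKmap]
    obtain ⟨g, hg, hgV⟩ : ∃ g ∈ binForms k, Q * Q * g ∉ Submodule.span ℂ (Set.range r) := by
      have := h.separates (Q * Q) (binForms.mul_mem hQ hQ) hQQ0
      push Not at this
      exact this
    have hgN : Q * Q * g ∈ N := ⟨g, hg, rfl⟩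
    obtain ⟨φ, hφz, hφ⟩ := Submodule.exists_le_ker_of_notMem hgV
    have h1 := finrank_le_finrank_add_one (V := N)
      (N := Submodule.span ℂ (Set.range r) ⊓ N) φ fun w hw hw0 =>
        ⟨h.mem_span_of_functional φ (fun i => hφ (mem_span i)) (hNmem hgN) hφz (hNmem hw) hw0, hw⟩
    have h2 : Submodule.span ℂ (Set.range r) ⊓ N < N :=
      lt_of_le_of_ne inf_le_right fun heq => hgV (heq.symm.le hgN).1
    have h3 := Submodule.finrank_lt_finrank_of_lt h2
    omega
  suffices heq : tangentSpaceAt V x = dotPerp K by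
    rw [heq]
    have := finrank_dotPerp K
    omega
  apply le_antisymm
  · intro v hv
    rw [mem_tangentSpaceAt] at hv
    rw [mem_dotPerp]
    rintro c ⟨u, hu, huc⟩
    rw [LinearMap.mulLeft_apply] at huc
    obtain ⟨i₀, hi₀⟩ : ∃ i, x.rep i ≠ 0 := Function.ne_iff.mp x.rep_nonzero
    -- every form of degree `4 (k + 2)` divisible by `Q ^ 2` is the pull-back of a quartic
    -- which is singular at `x`
    have hsing : ∀ g ∈ binForms ((k + 2 + (k + 1)) + (k + 2 + (k + 1))),
        ∃ F : MvPolynomial (Fin (k + 1 + 1)) ℂ, F.IsHomogeneous 4 ∧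
          MvPolynomial.aeval r F = Q * Q * g ∧
          ∀ i, MvPolynomial.eval x.rep (MvPolynomial.pderiv i F) = 0 := by
      intro g hg
      refine Submodule.mul_induction_on (binForms.add_le_mul _ _ hg) (fun f hf f' hf' => ?_)
        fun f f' hf hf' => ?_
      · have hlift : ∀ f ∈ binForms (k + 2 + (k + 1)), ∃ P : MvPolynomial (Fin (k + 1 + 1)) ℂ,
            P.IsHomogeneous 2 ∧ MvPolynomial.aeval r P = Q * f ∧
              MvPolynomial.eval x.rep P = 0 := by
          intro f hf
          obtain ⟨P, hP, hPr⟩ := h.exists_aeval_eq (A := Q * f) (by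
            have := binForms.mul_mem hQ hf
            rwa [show 1 + (k + 2 + (k + 1)) = k + 2 + (k + 2) by ring] at this)
          refine ⟨P, hP, hPr, ?_⟩
          rw [← hsx, ← eval_aeval_eq, hPr, map_mul, hQs, zero_mul]
        obtain ⟨P, hP, hPr, hPx⟩ := hlift f hf
        obtain ⟨P', hP', hPr', hPx'⟩ := hlift f' hf'
        refine ⟨P * P', hP.mul hP', ?_, fun i => ?_⟩
        · rw [map_mul, hPr, hPr']
          ring
        · rw [Derivation.leibniz, map_add, smul_eq_mul, smul_eq_mul, map_mul, map_mul, hPx, hPx',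
            zero_mul, zero_mul, add_zero]
      · obtain ⟨F, hF, hFr, hFx⟩ := hf
        obtain ⟨F', hF', hFr', hFx'⟩ := hf'
        refine ⟨F + F', hF.add hF', ?_, fun i => ?_⟩
        · rw [map_add, hFr, hFr', mul_add]
        · rw [map_add, map_add, hFx, hFx', add_zero]
    obtain ⟨F, hF, hFr, hFx⟩ := hsing (u * r i₀ ^ 3) (by
      have := binForms.mul_mem hu (binForms.mul_mem (h.mem i₀)
        (binForms.mul_mem (h.mem i₀) (h.mem i₀)))
      rw [show k + 2 + (k + 1) + (k + 2 + (k + 1)) = k + (k + 2 + (k + 2 + (k + 2))) by ring]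
      convert this using 2
      ring)
    set L : MvPolynomial (Fin (k + 1 + 1)) ℂ := ∑ i, c i • MvPolynomial.X i
    have hLhom : L.IsHomogeneous 1 :=
      Submodule.sum_mem (MvPolynomial.homogeneousSubmodule _ ℂ 1) fun i _ =>
        Submodule.smul_mem _ _ (MvPolynomial.isHomogeneous_X _ _)
    have hLr : MvPolynomial.aeval r L = Q * Q * u := by
      rw [huc, pullback_apply]
      simp only [L, map_sum, map_smul, MvPolynomial.aeval_X]
    have hLx : MvPolynomial.eval x.rep L = 0 := by
      rw [← hsx, ← eval_aeval_eq, hLr, map_mul, map_mul, hQs, zero_mul, zero_mul]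
    have hLd : ∀ i, MvPolynomial.pderiv i L = MvPolynomial.C (c i) := by
      intro i
      simp only [L, map_sum, Derivation.map_smul, MvPolynomial.pderiv_X]
      rw [Finset.sum_eq_single i]
      · simp [MvPolynomial.smul_eq_C_mul]
      · intro b _ hb
        simp [hb]
      · simp
    have hGhom : (L * MvPolynomial.X i₀ ^ 3 - F).IsHomogeneous 4 :=
      (hLhom.mul (MvPolynomial.isHomogeneous_X_pow i₀ 3)).sub hF
    have hvan := hv (L * MvPolynomial.X i₀ ^ 3 - F)
      ⟨⟨4, hGhom⟩, hV.eval_eq_zero (by omega) hGhom (by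
      rw [map_sub, map_mul, hLr, map_pow, MvPolynomial.aeval_X, hFr]
      ring)⟩
    have hgrad : ∀ i, MvPolynomial.eval x.rep
        (MvPolynomial.pderiv i (L * MvPolynomial.X i₀ ^ 3 - F)) = x.rep i₀ ^ 3 * c i := by
      intro i
      rw [map_sub, map_sub, hFx, Derivation.leibniz, map_add, smul_eq_mul, smul_eq_mul, map_mul,
        map_mul, hLx, hLd, zero_mul, zero_add, sub_zero, map_pow, MvPolynomial.eval_X,
        MvPolynomial.eval_C]
    simp only [hgrad, mul_assoc, ← Finset.mul_sum] at hvan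
    exact (mul_eq_zero.mp hvan).resolve_left (pow_ne_zero _ hi₀)
  · intro v hv
    rw [mem_tangentSpaceAt]
    rintro f ⟨⟨e, hfe⟩, hfV⟩
    obtain ⟨ω, hω, hωs⟩ := binForms.exists_mem_eval_eq_one (k + 2) hs
    have hdecomp : ∀ i, ∃ g ∈ binForms (k + 1),
        r i = MvPolynomial.C (x.rep i) * ω + Q * g := by
      intro i
      obtain ⟨g, hg, hgi⟩ := binForms.exists_eq_lin_mul (k := k + 1) (g := r i - x.rep i • ω)
        (Submodule.sub_mem _ (h.mem i) (Submodule.smul_mem _ _ hω)) hs (by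
          rw [map_sub, MvPolynomial.smul_eval, hωs, mul_one, hreps, sub_self])
      refine ⟨g, hg, ?_⟩
      rw [MvPolynomial.smul_eq_C_mul] at hgi
      rw [← hgi]
      ring
    choose g hg hrg using hdecomp
    refine mem_dotPerp.mp hv (fun i => MvPolynomial.eval x.rep (MvPolynomial.pderiv i f)) ?_
    obtain ⟨h1, h2⟩ := gradient_pullback hfe hrg (hV.aeval_eq_zero hfV)
      (hfV x hx _ (by
        rw [Projectivization.submodule_eq]; exact Submodule.mem_span_singleton_self _)) hQ0
    obtain ⟨p, hp, hpeq⟩ := binForms.exists_eq_mul_of_dvd_mul (j := k) hQ hQ0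
      (ω := ω ^ (e - 1)) (fun t ht ht' => by
        obtain ⟨a, rfl⟩ := binForms.exists_smul_of_eval_lin_eq_zero hs ht'
        rw [map_pow, binForms.eval_smul hω, hωs, mul_one]
        refine pow_ne_zero _ (pow_ne_zero _ ?_)
        rintro rfl
        exact ht (zero_smul _ _))
      (by
        rw [add_comm 1 k]
        exact Submodule.sum_mem _ fun i _ => Submodule.smul_mem _ _ (hg i)) h2
    refine ⟨p, hp, ?_⟩
    rw [pullback_apply, h1, hpeq, LinearMap.mulLeft_apply, mul_assoc]

end IsEmbedding

theorem isHypSet_of_ne_zero {n : ℕ} {c : Fin (n + 1) → ℂ} (hc : c ≠ 0) :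
    IsHypSet {x : PS ℂ n | ∑ i, c i * x.rep i = 0} := by
  refine ⟨dotPerp (Submodule.span ℂ {c}), ?_, ?_⟩
  · have := finrank_dotPerp (Submodule.span ℂ {c})
    rw [finrank_span_singleton hc] at this
    omega
  · ext x
    rw [Set.mem_ofPred_eq, Set.mem_ofPred_eq, Projectivization.submodule_eq,
      Submodule.span_singleton_le_iff_mem, mem_dotPerp]
    constructor
    · intro h b hb
      obtain ⟨a, rfl⟩ := Submodule.mem_span_singleton.mp hb
      simp only [Pi.smul_apply, smul_eq_mul, mul_assoc, ← Finset.mul_sum, h, mul_zero]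
    · exact fun h => h c (Submodule.mem_span_singleton_self c)

theorem IsHypSet.exists_ne_zero {n : ℕ} {S : Set (PS ℂ n)} (hS : IsHypSet S) :
    ∃ c : Fin (n + 1) → ℂ, c ≠ 0 ∧ ∀ x ∈ S, ∑ i, c i * x.rep i = 0 := by
  obtain ⟨W, hW, rfl⟩ := hS
  obtain ⟨f, hf, hfW⟩ := Submodule.exists_le_ker_of_lt_top W (lt_top_iff_ne_top.mpr fun htop => by
    rw [htop, finrank_top, Module.finrank_fin_fun] at hW
    omega)
  obtain ⟨c, rfl⟩ := (dotProductEquiv ℂ (Fin (n + 1))).surjective f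
  refine ⟨c, fun h0 => hf (by rw [h0, map_zero]), fun x hx => ?_⟩
  refine hfW (hx ?_)
  rw [Projectivization.submodule_eq]
  exact Submodule.mem_span_singleton_self _

/-- The points whose parameter is a zero of the binary form `G`. -/
def paramZeros {n : ℕ} (r : Fin (n + 1) → MvPolynomial (Fin 2) ℂ) (G : MvPolynomial (Fin 2) ℂ) :
    Set (PS ℂ n) :=
  {x | ∃ s : Fin 2 → ℂ, s ≠ 0 ∧ MvPolynomial.eval s G = 0 ∧ paramVec r s = x.rep}

theorem paramZeros_finite_ncard_le {n e d : ℕ} {r : Fin (n + 1) → MvPolynomial (Fin 2) ℂ}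
    {V : Set (PS ℂ n)} (hV : IsParamOf r V e) {G : MvPolynomial (Fin 2) ℂ} (hG : G ∈ binForms d)
    (hG0 : G ≠ 0) : (paramZeros r G).Finite ∧ (paramZeros r G).ncard ≤ d := by
  obtain ⟨a, ha, hroots⟩ := binForms.exists_roots hG hG0
  set P : Fin d → PS ℂ n := fun i => Projectivization.mk ℂ (paramVec r (a i)) (hV.2.1 _ (ha i))
  have hsub : paramZeros r G ⊆ P '' Set.univ := by
    rintro x ⟨s, hs, hsG, hsx⟩
    obtain ⟨i, c, rfl⟩ := hroots s hsG
    refine ⟨i, Set.mem_univ i, ?_⟩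
    rw [← Projectivization.mk_rep x]
    symm
    rw [Projectivization.mk_eq_mk_iff']
    exact ⟨c ^ e, by rw [← hsx, paramVec_smul hV.1]⟩
  have hfin : (P '' Set.univ).Finite := Set.toFinite _
  refine ⟨hfin.subset hsub, (Set.ncard_le_ncard hsub hfin).trans ?_⟩
  refine (Set.ncard_image_le Set.finite_univ).trans ?_
  rw [Set.ncard_univ, Nat.card_eq_fintype_card, Fintype.card_fin]

theorem eval_pullback {n : ℕ} (r : Fin (n + 1) → MvPolynomial (Fin 2) ℂ) (c : Fin (n + 1) → ℂ)
    (s : Fin 2 → ℂ) :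
    MvPolynomial.eval s (pullback r c) = ∑ i, c i * paramVec r s i := by
  rw [pullback_apply, map_sum]
  exact Finset.sum_congr rfl fun i _ => MvPolynomial.smul_eval _ _ _

theorem IsParamOf.inter_subset_paramZeros {n e : ℕ} {r : Fin (n + 1) → MvPolynomial (Fin 2) ℂ}
    {V S : Set (PS ℂ n)} (hV : IsParamOf r V e) (he : 0 < e) {c : Fin (n + 1) → ℂ}
    (hc : ∀ x ∈ S, ∑ i, c i * x.rep i = 0) : V ∩ S ⊆ paramZeros r (pullback r c) := by
  rintro x ⟨hxV, hxS⟩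
  obtain ⟨s, hs, hsx⟩ := hV.exists_eq_rep he hxV
  exact ⟨s, hs, by rw [eval_pullback, hsx]; exact hc x hxS, hsx⟩

theorem IsParamOf.isIrredAlg {n e : ℕ} {r : Fin (n + 1) → MvPolynomial (Fin 2) ℂ}
    {V : Set (PS ℂ n)} (hV : IsParamOf r V e) (he : 0 < e) (halg : IsAlg V) : IsIrredAlg V := by
  refine ⟨halg, ⟨_, hV.mk_mem (hV.2.1 ![1, 0] (by simp))⟩, ?_⟩
  rintro _ _ ⟨S₁, hS₁, rfl⟩ ⟨S₂, hS₂, rfl⟩ hsub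
  by_contra! hcon
  have hform : ∀ S : Set (MvPolynomial (Fin (n + 1)) ℂ), (∀ f ∈ S, ∃ d, f.IsHomogeneous d) →
      ¬ V ⊆ projZeroLocus S → ∃ f ∈ S, MvPolynomial.aeval r f ≠ 0 := by
    intro S hS hVS
    by_contra! h0
    refine hVS fun x hx f hf => ?_
    obtain ⟨d, hd⟩ := hS f hf
    exact hV.eval_eq_zero he hd (h0 f hf) x hx
  obtain ⟨f₁, hf₁, hf₁r⟩ := hform S₁ hS₁ hcon.1
  obtain ⟨f₂, hf₂, hf₂r⟩ := hform S₂ hS₂ hcon.2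
  obtain ⟨s, hs⟩ : ∃ s, MvPolynomial.eval s
      (MvPolynomial.X 0 * (MvPolynomial.aeval r f₁ * MvPolynomial.aeval r f₂)) ≠ 0 := by
    by_contra! h0
    exact mul_ne_zero (MvPolynomial.X_ne_zero (R := ℂ) 0) (mul_ne_zero hf₁r hf₂r)
      (MvPolynomial.funext fun s => by rw [h0 s, map_zero])
  rw [map_mul, map_mul, MvPolynomial.eval_X, eval_aeval_eq, eval_aeval_eq] at hs
  have hs0 : s ≠ 0 := by
    rintro rfl
    exact hs (by rw [Pi.zero_apply, zero_mul])
  have hmem : paramVec r s ∈ (Projectivization.mk ℂ (paramVec r s) (hV.2.1 s hs0)).submodule := by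
    rw [Projectivization.submodule_mk]
    exact Submodule.mem_span_singleton_self _
  rcases hsub (hV.mk_mem (hV.2.1 s hs0)) with h1 | h1
  · exact hs (by rw [h1 f₁ hf₁ _ hmem, zero_mul, mul_zero])
  · exact hs (by rw [h1 f₂ hf₂ _ hmem, mul_zero, mul_zero])

namespace IsEmbedding

variable {k : ℕ} {r : Fin (k + 1 + 1) → MvPolynomial (Fin 2) ℂ} {V : Set (PS ℂ (k + 1))}

theorem infinite (h : IsEmbedding r) (hV : IsParamOf r V (k + 2)) : V.Infinite := by
  have hne : ∀ u : ℂ, (![1, u] : Fin 2 → ℂ) ≠ 0 := fun u => by simp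
  refine Set.infinite_of_injective_forall_mem (α := ℂ)
    (f := fun u => Projectivization.mk ℂ (paramVec r ![1, u]) (h.paramVec_ne_zero (hne u)))
    (fun u w huw => ?_) fun u => hV.mk_mem _
  obtain ⟨c, hc⟩ := (Projectivization.mk_eq_mk_iff' _ _ _ _ _).mp huw
  obtain ⟨a, ha⟩ := h.exists_smul_eq (hne u) (hne w) hc.symm
  have h0 := congrFun ha 0
  have h1 := congrFun ha 1
  simp only [Pi.smul_apply, Matrix.cons_val_zero, Matrix.cons_val_one, smul_eq_mul] at h0 h1
  rw [mul_one] at h0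
  rw [h1, ← h0, one_mul]

/-- A functional which does not vanish on all binary forms of degree `m` does not vanish on the
`m`-th powers of two independent linear forms. -/
theorem exists_pow_lin_ne_zero {m : ℕ} {φ : MvPolynomial (Fin 2) ℂ →ₗ[ℂ] ℂ}
    {z : MvPolynomial (Fin 2) ℂ} (hz : z ∈ binForms m) (hφz : φ z ≠ 0) :
    ∃ u w : ℂ, u ≠ w ∧ φ (binForms.lin ![u, 1] ^ m) ≠ 0 ∧ φ (binForms.lin ![w, 1] ^ m) ≠ 0 := by
  set p : Polynomial ℂ := ∑ i ∈ Finset.range (m + 1),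
    Polynomial.C ((-1) ^ (m - i) * (m.choose i : ℂ) * φ (binForms.mono m i)) *
      Polynomial.X ^ (m - i) with hp
  have hpeval : ∀ u, p.eval u = φ (binForms.lin ![u, 1] ^ m) := by
    intro u
    have : binForms.lin ![u, 1] =
        (MvPolynomial.X 0 : MvPolynomial (Fin 2) ℂ) + MvPolynomial.C (-u) * MvPolynomial.X 1 := by
      simp [binForms.lin, sub_eq_add_neg]
    rw [this, add_pow, map_sum, hp, Polynomial.eval_finsetSum]
    refine Finset.sum_congr rfl fun i _ => ?_
    have : (MvPolynomial.X 0 : MvPolynomial (Fin 2) ℂ) ^ i *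
        (MvPolynomial.C (-u) * MvPolynomial.X 1) ^ (m - i) * (m.choose i : MvPolynomial (Fin 2) ℂ) =
        ((-u) ^ (m - i) * (m.choose i : ℂ)) • binForms.mono m i := by
      rw [MvPolynomial.smul_eq_C_mul, binForms.mono, mul_pow, MvPolynomial.C_mul,
        MvPolynomial.C_pow,
        map_natCast]
      ring
    rw [this, map_smul, smul_eq_mul]
    simp only [Polynomial.eval_mul, Polynomial.eval_C, Polynomial.eval_pow, Polynomial.eval_X]
    rw [neg_pow u]
    ring
  have hp0 : p ≠ 0 := by
    intro h0
    apply hφz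
    obtain ⟨c, rfl⟩ := binForms.exists_eq_sum_mono hz
    rw [map_sum]
    refine Finset.sum_eq_zero fun i _ => ?_
    have hi : (i : ℕ) ≤ m := Nat.lt_succ_iff.mp i.2
    have hcoeff := congrArg (fun q => Polynomial.coeff q (m - i)) h0
    simp only [hp, Polynomial.finsetSum_coeff, Polynomial.coeff_C_mul_X_pow,
      Polynomial.coeff_zero] at hcoeff
    rw [Finset.sum_eq_single (i : ℕ)] at hcoeff
    · rw [if_pos rfl] at hcoeff
      have hc : ((-1 : ℂ) ^ (m - i) * (m.choose i : ℂ)) ≠ 0 :=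
        mul_ne_zero (pow_ne_zero _ (by norm_num))
          (Nat.cast_ne_zero.mpr (Nat.choose_pos hi).ne')
      rw [map_smul, (mul_eq_zero.mp hcoeff).resolve_left hc, smul_zero]
    · intro b hb hbi
      rw [Finset.mem_range] at hb
      rw [if_neg (by omega)]
    · intro hi'
      exact absurd (Finset.mem_range.mpr i.2) hi'
  have hinf : {u : ℂ | p.eval u ≠ 0}.Infinite := by
    have : {u : ℂ | p.IsRoot u}.Finite := Polynomial.finite_setOfPred_isRoot hp0
    exact this.infinite_compl
  obtain ⟨u, hu, w, hw, huw⟩ := hinf.nontrivial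
  exact ⟨u, w, huw, by rw [← hpeval]; exact hu, by rw [← hpeval]; exact hw⟩

/-- Some hyperplane meets the curve in at least `k + 2` points. -/
theorem exists_hyperplane (h : IsEmbedding r) (hV : IsParamOf r V (k + 2)) :
    ∃ (c : Fin (k + 1 + 1) → ℂ) (P : Fin (k + 2) → PS ℂ (k + 1)), c ≠ 0 ∧ Function.Injective P ∧
      ∀ j, P j ∈ V ∧ ∑ i, c i * (P j).rep i = 0 := by
  obtain ⟨z, hz, hzV⟩ := h.exists_notMem
  obtain ⟨φ, hφz, hφ⟩ := Submodule.exists_le_ker_of_notMem hzV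
  obtain ⟨u, w, huw, hu, hw⟩ := exists_pow_lin_ne_zero hz hφz
  have huw' : u - w ≠ 0 := sub_ne_zero.mpr huw
  set A := binForms.lin ![u, 1]
  set B := binForms.lin ![w, 1]
  have hpow : ∀ t : ℂ, binForms.lin ![t, 1] ^ (k + 2) ∈ binForms (k + 2) := fun t => by
    have := MvPolynomial.IsHomogeneous.pow (binForms.lin_mem ![t, 1]) (k + 2)
    rwa [one_mul] at this
  set G := φ (B ^ (k + 2)) • A ^ (k + 2) - φ (A ^ (k + 2)) • B ^ (k + 2) with hGdef
  have hG : G ∈ LinearMap.range (pullback r) := by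
    rw [range_pullback]
    refine h.mem_span_of_functional φ (fun i => hφ (mem_span i)) hz hφz
      (Submodule.sub_mem _ (Submodule.smul_mem _ _ (hpow u)) (Submodule.smul_mem _ _ (hpow w))) ?_
    rw [hGdef, map_sub, map_smul, map_smul, smul_eq_mul, smul_eq_mul, mul_comm, sub_self]
  obtain ⟨c, hc⟩ := hG
  have hGeval : ∀ t, MvPolynomial.eval t G =
      φ (B ^ (k + 2)) * MvPolynomial.eval t A ^ (k + 2) -
        φ (A ^ (k + 2)) * MvPolynomial.eval t B ^ (k + 2) := fun t => by
    rw [hGdef, map_sub, MvPolynomial.smul_eval, MvPolynomial.smul_eval,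
      (MvPolynomial.eval t).map_pow, (MvPolynomial.eval t).map_pow]
  obtain ⟨ρ, hρ⟩ := IsAlgClosed.exists_pow_nat_eq (φ (A ^ (k + 2)) / φ (B ^ (k + 2)))
    (show 0 < k + 2 by omega)
  have hρ0 : ρ ≠ 0 := by
    rintro rfl
    rw [zero_pow (by omega)] at hρ
    exact div_ne_zero hu hw hρ.symm
  set ζ : ℂ := Complex.exp (2 * Real.pi * Complex.I / (k + 2 : ℕ))
  have hζ : IsPrimitiveRoot ζ (k + 2) := Complex.isPrimitiveRoot_exp (k + 2) (by omega)
  -- the parameter at which `A` and `B` take the values `ρ ζ ^ j` and `1`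
  set s : Fin (k + 2) → Fin 2 → ℂ := fun j =>
    ![1 + w * ((1 - ρ * ζ ^ (j : ℕ)) / (u - w)), (1 - ρ * ζ ^ (j : ℕ)) / (u - w)] with hs
  have hA : ∀ j, MvPolynomial.eval (s j) A = ρ * ζ ^ (j : ℕ) := by
    intro j
    simp only [A, binForms.eval_lin, hs, Matrix.cons_val_zero, Matrix.cons_val_one]
    field_simp
    ring
  have hB : ∀ j, MvPolynomial.eval (s j) B = 1 := by
    intro j
    simp only [B, binForms.eval_lin, hs, Matrix.cons_val_zero, Matrix.cons_val_one]
    ring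
  have hs0 : ∀ j, s j ≠ 0 := by
    intro j h0
    have := hB j
    rw [h0, binForms.eval_lin] at this
    simp at this
  refine ⟨c, fun j => Projectivization.mk ℂ (paramVec r (s j)) (h.paramVec_ne_zero (hs0 j)),
    ?_, ?_, fun j => ⟨hV.mk_mem _, ?_⟩⟩
  · rintro rfl
    rw [map_zero] at hc
    have := congrArg (MvPolynomial.eval ![w, 1]) hc
    rw [map_zero, hGeval, binForms.eval_lin_self, zero_pow (by omega), mul_zero,
      sub_zero, binForms.eval_lin] at this
    simp only [Matrix.cons_val_zero, Matrix.cons_val_one] at this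
    refine mul_ne_zero hw (pow_ne_zero _ ?_) this.symm
    rwa [one_mul, mul_one, ← neg_sub, neg_ne_zero]
  · intro i j hij
    obtain ⟨b, hb⟩ := (Projectivization.mk_eq_mk_iff' _ _ _ _ _).mp hij
    obtain ⟨a, ha⟩ := h.exists_smul_eq (hs0 i) (hs0 j) hb.symm
    have h1 := hB i
    rw [ha, binForms.eval_smul (binForms.lin_mem _), hB j, mul_one, pow_one] at h1
    have h2 := hA i
    rw [ha, h1, one_smul, hA j] at h2
    exact Fin.ext (hζ.pow_inj i.2 j.2 (mul_left_cancel₀ hρ0 h2).symm)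
  · obtain ⟨b, -, hb⟩ := exists_rep_eq_paramVec_smul h.mem (by omega)
      (h.paramVec_ne_zero (hs0 j))
    have hGmem : G ∈ binForms (k + 2) :=
      Submodule.sub_mem _ (Submodule.smul_mem _ _ (hpow u)) (Submodule.smul_mem _ _ (hpow w))
    rw [hb, ← eval_pullback, hc, binForms.eval_smul hGmem, hGeval, hA, hB, one_pow,
      mul_one, mul_pow, ← pow_mul,
      mul_comm (j : ℕ), pow_mul, hζ.pow_eq_one, one_pow, mul_one, hρ, mul_div_cancel₀ _ hw,
      sub_self, mul_zero]

theorem isCurveDeg (h : IsEmbedding r) (hV : IsParamOf r V (k + 2)) : IsCurveDeg V (k + 2) := by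
  have hbound : ∀ S, IsHypSet S → (V ∩ S).Finite ∧ (V ∩ S).ncard ≤ k + 2 := by
    intro S hS
    obtain ⟨c, hc, hcS⟩ := hS.exists_ne_zero
    have hG : pullback r c ∈ binForms (k + 2) := by
      apply h.span_le
      rw [← range_pullback]
      exact ⟨c, rfl⟩
    have hG0 : pullback r c ≠ 0 := fun h0 =>
      hc (pullback_injective h.linearIndependent (by rw [h0, map_zero]))
    obtain ⟨h1, h2⟩ := paramZeros_finite_ncard_le hV hG hG0
    have hsub := hV.inter_subset_paramZeros (by omega) hcS
    exact ⟨h1.subset hsub, (Set.ncard_le_ncard hsub h1).trans h2⟩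
  obtain ⟨c, P, hc, hP, hPV⟩ := h.exists_hyperplane hV
  have hS := isHypSet_of_ne_zero hc
  refine ⟨⟨h.isAlg hV, ⟨_, hS, (hbound _ hS).1⟩, fun C hC => ?_⟩,
    ⟨_, hS, (hbound _ hS).1, le_antisymm (hbound _ hS).2 ?_⟩, ?_⟩
  · rw [hC.2.2 V (hV.isIrredAlg (by omega) (h.isAlg hV)) subset_rfl hC.2.1]
    exact h.infinite hV
  · have hsub : Set.range P ⊆ V ∩ {x : PS ℂ (k + 1) | ∑ i, c i * x.rep i = 0} := by
      rintro _ ⟨j, rfl⟩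
      exact hPV j
    have := Set.ncard_le_ncard hsub (hbound _ hS).1
    rwa [Set.ncard_range_of_injective hP, Nat.card_eq_fintype_card, Fintype.card_fin] at this
  · rintro _ ⟨S, hS', -, rfl⟩
    exact (hbound S hS').2

end IsEmbedding

theorem IsParamOf.linearIndependent {n e : ℕ} {r : Fin (n + 1) → MvPolynomial (Fin 2) ℂ}
    {V : Set (PS ℂ n)} (hV : IsParamOf r V e) (he : 0 < e) (hnd : NonDeg V) :
    LinearIndependent ℂ r := by
  rw [Fintype.linearIndependent_iff]
  intro c hc
  by_contra! hcon
  refine hnd _ (isHypSet_of_ne_zero (c := c) fun h0 => ?_) fun x hx => ?_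
  · obtain ⟨i, hi⟩ := hcon
    exact hi (congrFun h0 i)
  · obtain ⟨s, -, hs⟩ := hV.exists_eq_rep he hx
    rw [Set.mem_ofPred_eq, ← hs, ← eval_pullback, pullback_apply, hc, map_zero]

/-- If a space `W` of binary forms of degree `j + 4` and dimension `j + 4` separates points and
tangent directions, then up to scaling there is at most one cubic all whose multiples lie
in `W`. -/
theorem finrank_colon_three_le_one {j : ℕ} (hj : 1 ≤ j)
    {W : Submodule ℂ (MvPolynomial (Fin 2) ℂ)} [FiniteDimensional ℂ W]
    (hW : Module.finrank ℂ W = j + 4)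
    (hsep : ∀ Q ∈ binForms 2, Q ≠ 0 → ¬ ∀ g ∈ binForms (j + 2), Q * g ∈ W) :
    Module.finrank ℂ (binForms.colon W 3 (j + 1)) ≤ 1 := by
  by_contra! hcon
  set d : ℕ → ℕ := fun i => Module.finrank ℂ (binForms.colon W i (j + 4 - i)) with hd
  have hconv : ∀ i, i + 2 ≤ j + 4 → 2 * d (i + 1) ≤ d i + d (i + 2) := by
    intro i hi
    have := binForms.finrank_colon_convex W i (j + 4 - (i + 2))
    rwa [show j + 4 - (i + 2) + 1 = j + 4 - (i + 1) by omega,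
      show j + 4 - (i + 2) + 2 = j + 4 - i by omega] at this
  have h2 : d 2 = 0 := by
    have : binForms.colon W 2 (j + 4 - 2) = ⊥ := by
      rw [Submodule.eq_bot_iff]
      intro Q hQ
      by_contra hQ0
      exact hsep Q hQ.1 hQ0 hQ.2
    simp only [hd]
    rw [this, finrank_bot]
  have h3 : d 2 + 2 ≤ d (2 + 1) := by
    rw [h2]
    exact hcon
  have hgrowth := convex_growth hconv h3 (j + 2) (by omega)
  have htop : d (2 + (j + 2)) ≤ Module.finrank ℂ W := by
    refine Submodule.finrank_mono fun g hg => ?_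
    have := hg.2 1 (by
      rw [show j + 4 - (2 + (j + 2)) = 0 by omega]
      exact MvPolynomial.isHomogeneous_one _ _)
    rwa [mul_one] at this
  omega

theorem apply_eq_sum_mul {N M : ℕ} (f : (Fin N → ℂ) →ₗ[ℂ] (Fin M → ℂ)) (v : Fin N → ℂ)
    (i : Fin M) : f v i = ∑ j, f (Pi.single j 1) i * v j := by
  rw [LinearMap.pi_apply_eq_sum_univ f v, Finset.sum_apply]
  refine Finset.sum_congr rfl fun j _ => ?_
  rw [Pi.smul_apply, smul_eq_mul, mul_comm]
  have hj : (fun l => if j = l then (1 : ℂ) else 0) = Pi.single j 1 := by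
    funext l
    simp [Pi.single_apply, eq_comm]
  rw [hj]

theorem surjective_of_ker_eq_submodule {n : ℕ} {x : PS ℂ (n + 1)}
    {f : (Fin (n + 2) → ℂ) →ₗ[ℂ] (Fin (n + 1) → ℂ)} (hf : LinearMap.ker f = x.submodule) :
    Function.Surjective f := by
  have h1 := LinearMap.finrank_range_add_finrank_ker f
  rw [hf, Projectivization.submodule_eq, finrank_span_singleton x.rep_nonzero,
    Module.finrank_fin_fun] at h1
  rw [← LinearMap.range_eq_top]
  apply Submodule.eq_top_of_finrank_eq
  rw [Module.finrank_fin_fun]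
  omega

/-- The coordinate functions of the projection from a point of a parametrised curve. -/
theorem exists_projected_param {n e : ℕ} {q : Fin (n + 2) → MvPolynomial (Fin 2) ℂ}
    (hq : ∀ i, q i ∈ binForms (e + 1)) (hli : LinearIndependent ℂ q)
    {a : Fin 2 → ℂ} (ha : a ≠ 0) {x : PS ℂ (n + 1)} (hx : paramVec q a = x.rep)
    {f : (Fin (n + 2) → ℂ) →ₗ[ℂ] (Fin (n + 1) → ℂ)} (hf : LinearMap.ker f = x.submodule) :
    ∃ r : Fin (n + 1) → MvPolynomial (Fin 2) ℂ, (∀ i, r i ∈ binForms e) ∧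
      LinearIndependent ℂ r ∧
      (∀ i, binForms.lin a * r i ∈ Submodule.span ℂ (Set.range q)) ∧
      ∀ s, f (paramVec q s) = MvPolynomial.eval s (binForms.lin a) • paramVec r s := by
  set F : Fin (n + 1) → MvPolynomial (Fin 2) ℂ := fun i =>
    pullback q fun j => f (Pi.single j 1) i with hF
  have hFeval : ∀ s i, MvPolynomial.eval s (F i) = f (paramVec q s) i := by
    intro s i
    rw [hF, eval_pullback, apply_eq_sum_mul f]
  have hFspan : ∀ i, F i ∈ Submodule.span ℂ (Set.range q) := by
    intro i
    rw [← range_pullback]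
    exact ⟨_, rfl⟩
  have hspan : Submodule.span ℂ (Set.range q) ≤ binForms (e + 1) := by
    rw [Submodule.span_le]
    rintro _ ⟨i, rfl⟩
    exact hq i
  have hfx : f x.rep = 0 := by
    rw [← LinearMap.mem_ker, hf, Projectivization.submodule_eq]
    exact Submodule.mem_span_singleton_self _
  have hr : ∀ i, ∃ g ∈ binForms e, F i = binForms.lin a * g := fun i =>
    binForms.exists_eq_lin_mul (hspan (hFspan i)) ha (by rw [hFeval, hx, hfx]; rfl)
  choose r hr hFr using hr
  refine ⟨r, hr, ?_, fun i => hFr i ▸ hFspan i, fun s => ?_⟩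
  · rw [Fintype.linearIndependent_iff]
    intro c hc i
    have hcF : pullback q (fun j => ∑ i, c i * f (Pi.single j 1) i) = 0 := by
      have h1 : ∑ i, c i • F i = 0 := by
        simp only [hFr, ← mul_smul_comm, ← Finset.mul_sum, hc, mul_zero]
      rw [← h1]
      simp only [hF, ← map_smul, ← map_sum]
      congr 1
      funext j
      simp [Finset.sum_apply]
    have hzero := pullback_injective hli (hcF.trans (map_zero _).symm)
    obtain ⟨v, hv⟩ := surjective_of_ker_eq_submodule hf (Pi.single i 1)
    have h2 : ∑ l, c l * f v l = 0 := by
      simp only [apply_eq_sum_mul f v, Finset.mul_sum]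
      rw [Finset.sum_comm]
      refine Finset.sum_eq_zero fun j _ => ?_
      have := congrFun hzero j
      simp only [← mul_assoc, ← Finset.sum_mul]
      rw [show ∑ l, c l * f (Pi.single j 1) l = 0 from this, zero_mul]
    rw [hv] at h2
    simpa [Pi.single_apply] using h2
  · funext i
    rw [← hFeval, hFr, map_mul]
    rfl

/-- The Zariski closure of the projection of a parametrised curve from one of its points. -/
theorem zclosure_projImage_eq {n e : ℕ} (he : 0 < e) {q : Fin (n + 2) → MvPolynomial (Fin 2) ℂ}
    {r : Fin (n + 1) → MvPolynomial (Fin 2) ℂ} {δ : Set (PS ℂ (n + 1))} {C : Set (PS ℂ n)}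
    (hδ : IsParamOf q δ (e + 1)) (hC : IsParamOf r C e) (halg : IsAlg C)
    {a : Fin 2 → ℂ} (ha : a ≠ 0) {x : PS ℂ (n + 1)}
    {f : (Fin (n + 2) → ℂ) →ₗ[ℂ] (Fin (n + 1) → ℂ)} (hf : LinearMap.ker f = x.submodule)
    (hfq : ∀ s, f (paramVec q s) = MvPolynomial.eval s (binForms.lin a) • paramVec r s) :
    zclosure (projImage f (δ \ {x})) = C := by
  apply Set.Subset.antisymm
  · refine Set.sInter_subset_of_mem ⟨halg, ?_⟩
    rintro _ ⟨y, hy, hfy, rfl⟩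
    obtain ⟨s, -, hs⟩ := hδ.exists_eq_rep (by omega) hy.1
    have hfy' : f y.rep = MvPolynomial.eval s (binForms.lin a) • paramVec r s := by
      rw [← hs, hfq]
    have hr0 : paramVec r s ≠ 0 := fun h0 => hfy (by rw [hfy', h0, smul_zero])
    have : Projectivization.mk ℂ (f y.rep) hfy = Projectivization.mk ℂ (paramVec r s) hr0 :=
      (Projectivization.mk_eq_mk_iff' _ _ _ _ _).mpr ⟨_, hfy'.symm⟩
    rw [this]
    exact hC.mk_mem hr0
  · refine Set.subset_sInter ?_
    rintro _ ⟨⟨S, hS, rfl⟩, hsub⟩ y hy g hg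
    obtain ⟨d, hd⟩ := hS g hg
    refine hC.eval_eq_zero he hd ?_ y hy
    refine (mul_eq_zero.mp (?_ : binForms.lin a * MvPolynomial.aeval r g = 0)).resolve_left
      (binForms.lin_ne_zero ha)
    apply MvPolynomial.funext
    intro s
    rw [map_mul, map_zero, eval_aeval_eq]
    by_cases hsa : MvPolynomial.eval s (binForms.lin a) = 0
    · rw [hsa, zero_mul]
    have hs : s ≠ 0 := by
      rintro rfl
      exact hsa (by rw [binForms.eval_lin]; simp)
    have hq0 := hδ.2.1 s hs
    obtain ⟨b, hb, hrep⟩ := exists_rep_eq_paramVec_smul hδ.1 (by omega) hq0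
    set z := Projectivization.mk ℂ (paramVec q s) hq0
    have hfz : f z.rep = (b ^ (e + 1) * MvPolynomial.eval s (binForms.lin a)) • paramVec r s := by
      rw [hrep, paramVec_smul hδ.1, map_smul, hfq, smul_smul]
    have hcoef : b ^ (e + 1) * MvPolynomial.eval s (binForms.lin a) ≠ 0 :=
      mul_ne_zero (pow_ne_zero _ hb) hsa
    have hfz0 : f z.rep ≠ 0 := by
      rw [hfz]
      exact smul_ne_zero hcoef (hC.2.1 s hs)
    have hzx : z ≠ x := by
      rintro hzx
      apply hfz0
      rw [← LinearMap.mem_ker, hf, hzx, Projectivization.submodule_eq]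
      exact Submodule.mem_span_singleton_self _
    have := hsub ⟨z, ⟨hδ.mk_mem hq0, hzx⟩, hfz0, rfl⟩ g hg (paramVec r s) (by
      rw [Projectivization.submodule_mk, Submodule.mem_span_singleton]
      exact ⟨_, by rw [hfz, inv_smul_smul₀ hcoef]⟩)
    rw [this, mul_zero]

/-- Lemma 3.8.
Let `δ` be a smooth rational curve of degree `d + 1` in `ℂPᵈ`, `d ≥ 4` (below `d = n + 1`
with `n ≥ 3`), i.e. `δ` is irreducible, non-degenerate, rational and smooth. Then for all
but at most three points `q ∈ δ`, the Zariski closure of the projection `π_q(δ ∖ {q})` is a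
smooth rational curve of degree `d` in `ℂP^{d-1}`. -/
theorem projection_of_smooth_rational_curve
    (n : ℕ) (hn : 3 ≤ n) (δ : Set (PS ℂ (n + 1)))
    (h1 : IsIrredAlg δ) (h2 : NonDeg δ) (h3 : IsCurveDeg δ (n + 2))
    (h4 : IsRationalCurve δ (n + 2)) (h5 : IsSmoothCurve δ) :
    ∃ T : Set (PS ℂ (n + 1)), T ⊆ δ ∧ T.Finite ∧ T.ncard ≤ 3 ∧
      ∀ q ∈ δ \ T, ∀ f : (Fin (n + 2) → ℂ) →ₗ[ℂ] (Fin (n + 1) → ℂ),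
        LinearMap.ker f = q.submodule →
          IsSmoothCurve (zclosure (projImage f (δ \ {q}))) ∧
          IsRationalCurve (zclosure (projImage f (δ \ {q}))) (n + 1) ∧
          IsCurveDeg (zclosure (projImage f (δ \ {q}))) (n + 1) := by
  obtain ⟨j, rfl⟩ : ∃ j, n = j + 1 + 1 := ⟨n - 2, by omega⟩
  obtain ⟨q, hq⟩ := h4
  have hli := hq.linearIndependent (by omega) h2
  have hsep : ∀ Q ∈ binForms 2, Q ≠ 0 → ¬ ∀ g ∈ binForms (j + 2),
      Q * g ∈ Submodule.span ℂ (Set.range q) :=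
    fun Q hQ hQ0 => not_mul_mem_span_of_smooth hq hli h5 hQ hQ0
  set W := Submodule.span ℂ (Set.range q)
  have hWfin : FiniteDimensional ℂ W := FiniteDimensional.span_of_finite ℂ (Set.finite_range q)
  have hWrank : Module.finrank ℂ W = j + 4 := by
    rw [finrank_span_eq_card hli, Fintype.card_fin]
  obtain ⟨⟨G, hG⟩, hGgen⟩ :=
    finrank_le_one_iff.mp (finrank_colon_three_le_one (by omega) hWrank hsep)
  set T : Set (PS ℂ (j + 1 + 1 + 1)) := {x | x ∈ δ ∧ ∃ a : Fin 2 → ℂ, a ≠ 0 ∧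
    paramVec q a = x.rep ∧ ∃ Q ∈ binForms 2, Q ≠ 0 ∧
      ∀ g ∈ binForms (j + 1), binForms.lin a * Q * g ∈ W}
  have hTG : ∀ x ∈ T, G ≠ 0 ∧ x ∈ paramZeros q G := by
    rintro x ⟨-, a, ha, hax, Q, hQ, hQ0, hQW⟩
    obtain ⟨c, hc⟩ := hGgen ⟨binForms.lin a * Q, binForms.mul_mem (binForms.lin_mem a) hQ, hQW⟩
    have hc' : c • G = binForms.lin a * Q := congrArg Subtype.val hc
    have hne : c • G ≠ 0 := hc' ▸ mul_ne_zero (binForms.lin_ne_zero ha) hQ0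
    refine ⟨right_ne_zero_of_smul hne, a, ha, ?_, hax⟩
    have := congrArg (MvPolynomial.eval a) hc'
    rw [MvPolynomial.smul_eval, map_mul, binForms.eval_lin_self, zero_mul] at this
    exact (mul_eq_zero.mp this).resolve_left (left_ne_zero_of_smul hne)
  have hTfin : T.Finite ∧ T.ncard ≤ 3 := by
    by_cases hG0 : G = 0
    · have : T = ∅ := Set.eq_empty_of_forall_notMem fun x hx => (hTG x hx).1 hG0
      rw [this]
      simp
    · obtain ⟨hfin, hcard⟩ := paramZeros_finite_ncard_le hq hG.1 hG0
      have hsub : T ⊆ paramZeros q G := fun x hx => (hTG x hx).2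
      exact ⟨hfin.subset hsub, (Set.ncard_le_ncard hsub hfin).trans hcard⟩
  refine ⟨T, fun x hx => hx.1, hTfin.1, hTfin.2, ?_⟩
  rintro x ⟨hxδ, hxT⟩ f hf
  obtain ⟨a, ha, hax⟩ := hq.exists_eq_rep (by omega) hxδ
  obtain ⟨r, hr, hrli, hrW, hfq⟩ := exists_projected_param hq.1 hli ha hax hf
  have hemb : IsEmbedding r := by
    refine ⟨hr, hrli, fun Q hQ hQ0 hcon => hxT ⟨hxδ, a, ha, hax, Q, hQ, hQ0, fun g hg => ?_⟩⟩
    have hle : Submodule.span ℂ (Set.range r) ≤ W.comap (binForms.mulBy (binForms.lin a)) := by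
      rw [Submodule.span_le]
      rintro _ ⟨i, rfl⟩
      exact hrW i
    rw [mul_assoc]
    exact hle (hcon g hg)
  have hC : IsParamOf r {y : PS ℂ (j + 1 + 1) | ∃ s : Fin 2 → ℂ,
      ∃ hs : (fun i => MvPolynomial.eval s (r i)) ≠ 0,
        y = Projectivization.mk ℂ (fun i => MvPolynomial.eval s (r i)) hs} (j + 1 + 1 + 1) :=
    ⟨hr, fun s hs => hemb.paramVec_ne_zero hs, rfl⟩
  rw [zclosure_projImage_eq (by omega) hq hC (hemb.isAlg hC) ha hf hfq]
  exact ⟨hemb.isSmoothCurve hC, ⟨r, hC⟩, hemb.isCurveDeg hC⟩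
end
end

section
/- Let d ≥ 2. If p ∈ Tan_ℂ(ν_{d+1}), then there exist binary linear forms L₁, L₂ such that f_p(x,y) = L₁(x,y)^d · L₂(x,y). Moreover, if p ∉ ν_{d+1} then L₁ and L₂ are linearly independent, and if p ∈ ℝP^{d+1} then L₁ and L₂ are both real. -/
open Classical
noncomputable section

/-- The standard parametrisation of the rational normal curve `ν_{d+1}` in `ℂP^{d+1}`:
`[x, y] ↦ [y^{d+1}, -x y^d, x² y^{d-1}, …, (-x)^d y, (-x)^{d+1}]`. -/
def nuVec (d : ℕ) (x y : ℂ) : Fin (d + 2) → ℂ :=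
  fun i => (-x) ^ (i : ℕ) * y ^ (d + 1 - (i : ℕ))

/-- The partial derivative of `nuVec` with respect to `x`. -/
def nuDx (d : ℕ) (x y : ℂ) : Fin (d + 2) → ℂ :=
  fun i => -(((i : ℕ) : ℂ)) * (-x) ^ ((i : ℕ) - 1) * y ^ (d + 1 - (i : ℕ))

/-- The partial derivative of `nuVec` with respect to `y`. -/
def nuDy (d : ℕ) (x y : ℂ) : Fin (d + 2) → ℂ :=
  fun i => ((d + 1 - (i : ℕ) : ℕ) : ℂ) * (-x) ^ (i : ℕ) * y ^ (d - (i : ℕ))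

/-- `q` lies on the affine cone over the rational normal curve `ν_{d+1}`. -/
def InNuCone (d : ℕ) (q : Fin (d + 2) → ℂ) : Prop :=
  ∃ x y c : ℂ, ¬(x = 0 ∧ y = 0) ∧ q = c • nuVec d x y

/-- `q` lies on the affine cone over the tangent variety `Tan_ℂ(ν_{d+1})`. -/
def InTanCone (d : ℕ) (q : Fin (d + 2) → ℂ) : Prop :=
  ∃ x y : ℂ, ¬(x = 0 ∧ y = 0) ∧ q ∈ Submodule.span ℂ {nuDx d x y, nuDy d x y}

/-- `q` lies on the affine cone over the secant variety `Sec_ℂ(ν_{d+1})`: it lies on a line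
through two distinct points of `ν_{d+1}`, or on a tangent line of `ν_{d+1}`. -/
def InSecCone (d : ℕ) (q : Fin (d + 2) → ℂ) : Prop :=
  (∃ x₁ y₁ x₂ y₂ : ℂ, ¬(x₁ = 0 ∧ y₁ = 0) ∧ ¬(x₂ = 0 ∧ y₂ = 0) ∧ x₁ * y₂ - x₂ * y₁ ≠ 0 ∧
      q ∈ Submodule.span ℂ {nuVec d x₁ y₁, nuVec d x₂ y₂}) ∨ InTanCone d q

/-- `q` lies on the affine cone over the real secant variety `Sec_ℝ(ν_{d+1})`: `q` is real and
lies on a line through two distinct real points of `ν_{d+1}` or on a real tangent line. -/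
def InSecRCone (d : ℕ) (q : Fin (d + 2) → ℂ) : Prop :=
  (∀ i, (q i).im = 0) ∧
  ((∃ x₁ y₁ x₂ y₂ : ℝ, ¬(x₁ = 0 ∧ y₁ = 0) ∧ ¬(x₂ = 0 ∧ y₂ = 0) ∧ x₁ * y₂ - x₂ * y₁ ≠ 0 ∧
      q ∈ Submodule.span ℂ {nuVec d x₁ y₁, nuVec d x₂ y₂}) ∨
    (∃ x y : ℝ, ¬(x = 0 ∧ y = 0) ∧ q ∈ Submodule.span ℂ {nuDx d x y, nuDy d x y}))

/-- The fundamental binary form `f_p(x,y) = ∑ p_i (d+1 choose i) x^{d+1-i} y^i`. -/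
def fForm (d : ℕ) (p : Fin (d + 2) → ℂ) (x y : ℂ) : ℂ :=
  ∑ i : Fin (d + 2), p i * ((d + 1).choose (i : ℕ) : ℂ) * x ^ (d + 1 - (i : ℕ)) * y ^ (i : ℕ)

/-- The polarisation `F_p = ∑ p_i P_i` of the fundamental binary form, where
`P_i = ∑_{|I| = i} ∏_{j ∉ I} x_j ∏_{j ∈ I} y_j`. -/
def Fpol (d : ℕ) (p : Fin (d + 2) → ℂ) (X Y : Fin (d + 1) → ℂ) : ℂ :=
  ∑ I : Finset (Fin (d + 1)),
    p ⟨I.card, by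
        have h : I.card ≤ d + 1 := by simpa using I.card_le_univ
        omega⟩ *
      ((∏ j ∈ Iᶜ, X j) * ∏ j ∈ I, Y j)

/-- The `(k+1) × (d-k+2)` Hankel matrix `M_k(p)` with entries `p_{i+j}`. -/
def hankel (d k : ℕ) (hk : k ≤ d) (p : Fin (d + 2) → ℂ) :
    Matrix (Fin (k + 1)) (Fin (d - k + 2)) ℂ :=
  fun i j => p ⟨(i : ℕ) + (j : ℕ), by have hi := i.isLt; have hj := j.isLt; omega⟩

/-- The fundamental binary form of `nuDx d s t` is the `s`-derivative of `(t x - s y)^{d+1}`. -/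
theorem fForm_nuDx (d : ℕ) (s t x y : ℂ) :
    fForm d (nuDx d s t) x y = (d + 1) * (t * x - s * y) ^ d * (-y) := by
  have h : t * x - s * y = (-s * y) + t * x := by ring
  rw [h, add_pow, Finset.mul_sum, Finset.sum_mul, ← Fin.sum_univ_eq_sum_range
    (fun i => ((d : ℂ) + 1) * ((-s * y) ^ i * (t * x) ^ (d - i) * (d.choose i : ℂ)) * (-y))]
  unfold fForm nuDx
  rw [Fin.sum_univ_succ]
  simp only [Fin.val_zero, Nat.cast_zero, neg_zero, zero_mul, zero_add]
  refine Finset.sum_congr rfl fun i _ => ?_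
  have hc : ((d : ℂ) + 1) * (d.choose i : ℂ) = ((d + 1).choose (i + 1) : ℂ) * ((i : ℕ) + 1) := by
    exact_mod_cast Nat.add_one_mul_choose_eq d i
  simp only [Fin.val_succ, Nat.add_sub_add_right, Nat.add_sub_cancel, Nat.cast_add, Nat.cast_one,
    mul_pow, pow_succ]
  linear_combination (-s) ^ (i : ℕ) * y ^ (i : ℕ) * t ^ (d - i) * x ^ (d - i) * y * hc

/-- The fundamental binary form of `nuDy d s t` is the `t`-derivative of `(t x - s y)^{d+1}`. -/
theorem fForm_nuDy (d : ℕ) (s t x y : ℂ) :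
    fForm d (nuDy d s t) x y = (d + 1) * (t * x - s * y) ^ d * x := by
  have h : t * x - s * y = (-s * y) + t * x := by ring
  rw [h, add_pow, Finset.mul_sum, Finset.sum_mul, ← Fin.sum_univ_eq_sum_range
    (fun i => ((d : ℂ) + 1) * ((-s * y) ^ i * (t * x) ^ (d - i) * (d.choose i : ℂ)) * x)]
  unfold fForm nuDy
  rw [Fin.sum_univ_castSucc]
  simp only [Fin.val_last, Nat.sub_self, Nat.cast_zero, zero_mul, add_zero]
  refine Finset.sum_congr rfl fun i _ => ?_
  have hc : (d.choose i : ℂ) * ((d : ℂ) + 1) =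
      ((d + 1).choose i : ℂ) * ((d + 1 - (i : ℕ) : ℕ) : ℂ) := by
    exact_mod_cast Nat.choose_mul_succ_eq d i
  have hi : d + 1 - (i : ℕ) = (d - i) + 1 := by omega
  have hx : x ^ (d + 1 - (i : ℕ)) = x ^ (d - (i : ℕ)) * x := by rw [hi, pow_succ]
  simp only [Fin.val_castSucc, mul_pow, hx]
  linear_combination -(-s) ^ (i : ℕ) * y ^ (i : ℕ) * t ^ (d - i) * x ^ (d - i) * x * hc

theorem fForm_add_smul (d : ℕ) (p q : Fin (d + 2) → ℂ) (α β x y : ℂ) :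
    fForm d (α • p + β • q) x y = α * fForm d p x y + β * fForm d q x y := by
  simp only [fForm, Finset.mul_sum, ← Finset.sum_add_distrib, Pi.add_apply, Pi.smul_apply,
    smul_eq_mul]
  exact Finset.sum_congr rfl fun i _ => by ring

/-- Euler's identity for the parametrisation of the rational normal curve. -/
theorem smul_nuDx_add_smul_nuDy (d : ℕ) (s t : ℂ) :
    s • nuDx d s t + t • nuDy d s t = ((d : ℂ) + 1) • nuVec d s t := by
  funext ⟨i, hi⟩
  simp only [nuDx, nuDy, nuVec, Pi.add_apply, Pi.smul_apply, smul_eq_mul]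
  have hs : s * (-(i : ℂ) * (-s) ^ (i - 1)) = i * (-s) ^ i := by
    cases i with
    | zero => simp
    | succ k => rw [Nat.add_sub_cancel, pow_succ]; ring
  have ht : t * (((d + 1 - i : ℕ) : ℂ) * t ^ (d - i)) = ((d + 1 - i : ℕ) : ℂ) * t ^ (d + 1 - i) := by
    rcases Nat.lt_or_ge d i with h | h
    · simp [show d + 1 - i = 0 by omega]
    · rw [show d + 1 - i = (d - i) + 1 by omega, pow_succ]; ring
  have hc : (i : ℂ) + ((d + 1 - i : ℕ) : ℂ) = d + 1 := by
    exact_mod_cast (by omega : i + (d + 1 - i) = d + 1)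
  linear_combination t ^ (d + 1 - i) * hs + (-s) ^ i * ht + (-s) ^ i * t ^ (d + 1 - i) * hc

open ComplexConjugate in
theorem conj_fForm_of_real {d : ℕ} {p : Fin (d + 2) → ℂ} (hp : ∀ i, (p i).im = 0) (x y : ℂ) :
    conj (fForm d p x y) = fForm d p (conj x) (conj y) := by
  simp only [fForm, map_sum, map_mul, map_pow, map_natCast]
  exact Finset.sum_congr rfl fun i _ => by rw [Complex.conj_eq_iff_im.2 (hp i)]

open ComplexConjugate in
/-- If `(x - r)^d (A x + B)` with `d ≥ 2` is a nonzero polynomial invariant under conjugation,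
then `r`, `A` and `B` are real. -/
theorem real_of_conj_invariant {d : ℕ} (hd : 2 ≤ d) {r A B : ℂ} (hAB : ¬(A = 0 ∧ B = 0))
    (h : ∀ z : ℂ, (z - r) ^ d * (A * z + B) = (z - conj r) ^ d * (conj A * z + conj B)) :
    conj r = r ∧ conj A = A ∧ conj B = B := by
  have hd0 : d ≠ 0 := by omega
  have hr : conj r = r := by
    by_contra hne
    have hc : r - conj r ≠ 0 := sub_ne_zero.2 (Ne.symm hne)
    have h₁ : conj A * r + conj B = 0 := by
      have := h r
      simp only [sub_self, zero_pow hd0, zero_mul] at this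
      exact (mul_eq_zero.1 this.symm).resolve_left (pow_ne_zero _ hc)
    have h₂ : A * conj r + B = 0 := by simpa using congrArg conj h₁
    have h₃ := h (r + (r - conj r))
    have e₁ : A * (r + (r - conj r)) + B = 2 * (A * (r - conj r)) := by linear_combination h₂
    have e₂ : conj A * (r + (r - conj r)) + conj B = conj A * (r - conj r) := by
      linear_combination h₁
    have e₃ : r + (r - conj r) - conj r = 2 * (r - conj r) := by ring
    rw [e₁, e₂, e₃, add_sub_cancel_left] at h₃
    have h₄ := congrArg norm h₃
    simp only [norm_mul, norm_pow, RCLike.norm_conj, Complex.norm_two, mul_pow] at h₄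
    have hA : A ≠ 0 := by
      rintro rfl
      exact hAB ⟨rfl, by simpa using h₂⟩
    have hpos : 0 < ‖r - conj r‖ ^ d * (‖A‖ * ‖r - conj r‖) := by positivity
    have h₅ : (2 : ℝ) ^ d = 2 := by
      refine mul_right_cancel₀ hpos.ne' ?_
      linear_combination -h₄
    have h₆ : (2 : ℝ) ^ 2 ≤ 2 ^ d := pow_le_pow_right₀ (by norm_num) hd
    linarith
  rw [hr] at h
  have g₁ := h (r + 1)
  have g₂ := h (r - 1)
  simp only [add_sub_cancel_left, one_pow, one_mul] at g₁
  rw [show r - 1 - r = -1 by ring] at g₂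
  have g₃ := mul_left_cancel₀ (pow_ne_zero d (by norm_num : (-1 : ℂ) ≠ 0)) g₂
  exact ⟨hr, by linear_combination (g₃ - g₁) / 2,
    by linear_combination (r - 1) / 2 * g₁ - (r + 1) / 2 * g₃⟩

/-- Theorem 3.9(i), Sylvester.
Let `d ≥ 2`. If `p ∈ Tan_ℂ(ν_{d+1})`, then there are binary linear forms `L₁, L₂` with
`f_p = L₁^d·L₂`. Moreover, if `p ∉ ν_{d+1}` then `L₁` and `L₂` are linearly independent, and
if `p` is real then `L₁` and `L₂` are both real. -/
theorem sylvester_tangent_case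
    (d : ℕ) (hd : 2 ≤ d) (p : Fin (d + 2) → ℂ) (hp : p ≠ 0) (hTan : InTanCone d p) :
    ∃ a₁ b₁ a₂ b₂ : ℂ,
      (∀ x y : ℂ, fForm d p x y = (a₁ * x + b₁ * y) ^ d * (a₂ * x + b₂ * y)) ∧
      (¬InNuCone d p → a₁ * b₂ - a₂ * b₁ ≠ 0) ∧
      ((∀ i, (p i).im = 0) → a₁.im = 0 ∧ b₁.im = 0 ∧ a₂.im = 0 ∧ b₂.im = 0) := by
  obtain ⟨s, t, hst, hmem⟩ := hTan
  obtain ⟨α, β, hαβ⟩ := Submodule.mem_span_pair.1 hmem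
  have hd1 : (d : ℂ) + 1 ≠ 0 := by exact_mod_cast d.succ_ne_zero
  have hf (x y : ℂ) : fForm d p x y =
      (d + 1) * (t * x - s * y) ^ d * (β * x - α * y) := by
    rw [← hαβ, fForm_add_smul, fForm_nuDx, fForm_nuDy]
    ring
  have hαβ0 : ¬(β = 0 ∧ α = 0) := by
    rintro ⟨rfl, rfl⟩
    exact hp (by simpa using hαβ.symm)
  have hdet (hnu : ¬InNuCone d p) : β * s - α * t ≠ 0 := by
    intro h0
    refine hnu ?_
    have key : ∃ k : ℂ, α = k * s ∧ β = k * t := by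
      by_cases ht : t = 0
      · have hs : s ≠ 0 := fun hs => hst ⟨hs, ht⟩
        refine ⟨α / s, by field_simp, ?_⟩
        field_simp
        linear_combination h0
      · refine ⟨β / t, ?_, by field_simp⟩
        field_simp
        linear_combination -h0
    obtain ⟨k, rfl, rfl⟩ := key
    refine ⟨s, t, k * (d + 1), hst, ?_⟩
    rw [← hαβ, mul_smul, mul_smul, mul_smul, ← smul_add, smul_nuDx_add_smul_nuDy]
  by_cases ht : t = 0
  · subst ht
    have hs : s ≠ 0 := fun hs => hst ⟨hs, rfl⟩
    have hform (x y : ℂ) : fForm d p x y = (0 * x + 1 * y) ^ d *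
        ((d + 1) * (-s) ^ d * β * x + -((d + 1) * (-s) ^ d * α) * y) := by
      rw [hf, show (0 : ℂ) * x - s * y = -s * y by ring, mul_pow]
      ring
    refine ⟨0, 1, _, _, hform, fun hnu => ?_, fun hre => ?_⟩
    · have hβ : β ≠ 0 := by
        rintro rfl
        exact hdet hnu (by ring)
      simp [hβ, hs, hd1]
    · have h₁ := conj_fForm_of_real hre 0 1
      have h₂ := conj_fForm_of_real hre 1 1
      rw [hform, map_zero, map_one, hform] at h₁
      rw [hform, map_one, hform] at h₂
      simp only [mul_zero, one_mul, mul_one, zero_add, one_pow, map_add] at h₁ h₂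
      rw [h₁] at h₂
      exact ⟨rfl, rfl, Complex.conj_eq_iff_im.1 (add_right_cancel h₂),
        Complex.conj_eq_iff_im.1 h₁⟩
  · have hform (x y : ℂ) : fForm d p x y = (1 * x + -(s / t) * y) ^ d *
        ((d + 1) * t ^ d * β * x + -((d + 1) * t ^ d * α) * y) := by
      rw [hf, show t * x - s * y = t * (1 * x + -(s / t) * y) by field_simp; ring, mul_pow]
      ring
    refine ⟨1, -(s / t), _, _, hform, fun hnu h0 => hdet hnu ?_, fun hre => ?_⟩
    · have hk : ((d : ℂ) + 1) * t ^ d ≠ 0 := mul_ne_zero hd1 (pow_ne_zero _ ht)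
      refine mul_left_cancel₀ hk ?_
      field_simp at h0
      linear_combination h0
    · have hne : ¬((d + 1) * t ^ d * β = 0 ∧ -((d + 1) * t ^ d * α) = 0) := by
        simpa [hd1, ht] using hαβ0
      obtain ⟨hr, hA, hB⟩ := real_of_conj_invariant (r := s / t) hd hne fun z => by
        have h := conj_fForm_of_real hre (starRingEnd ℂ z) 1
        rw [Complex.conj_conj, map_one, hform, hform] at h
        simp only [map_mul, map_add, map_sub, map_neg, map_pow, map_one, Complex.conj_conj,
          mul_one, one_mul, ← sub_eq_add_neg] at h ⊢
        exact h.symm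
      refine ⟨rfl, ?_, Complex.conj_eq_iff_im.1 hA, Complex.conj_eq_iff_im.1 hB⟩
      rw [Complex.neg_im, Complex.conj_eq_iff_im.1 hr, neg_zero]
end
end
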